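/- arXiv:1601.02972 — 6 statements merged into one kernel-verified Lean document; each statement's English description precedes it below -/
import Mathlib

section
/- For every fixed r ≥ 1, the function s ↦ θ₄(rs)·θ₄(r/s) − 2·θₒ(rs)·θₒ(r/s) on (0, ∞) attains its global maximum at s = 1; that is, for all s > 0, θ₄(rs)·θ₄(r/s) − 2·θₒ(rs)·θₒ(r/s) ≤ θ₄(r)² − 2·θₒ(r)². -/
noncomputable def theta4 (s : ℝ) : ℝ := ∑' k : ℤ, (-1 : ℝ) ^ k * Real.exp (-Real.pi * (k : ℝ) ^ 2 * s)

noncomputable def thetaO (s : ℝ) : ℝ := ∑' k : ℤ, Real.exp (-Real.pi * (2 * (k : ℝ) + 1) ^ 2 * s)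

open Real in
theorem aux_summable {t : ℝ} (ht : 0 < t) :
    Summable (fun k : ℤ => exp (-π * (k : ℝ) ^ 2 * t)) := by
  have h := HurwitzKernelBounds.summable_f_int 0 0 ht
  refine h.congr ?_
  intro k
  simp [HurwitzKernelBounds.f_int]

noncomputable def auxEV (t : ℝ) : ℝ := ∑' k : ℤ, Real.exp (-Real.pi * (2 * (k : ℝ)) ^ 2 * t)

open Real in
theorem aux_summable_even {t : ℝ} (ht : 0 < t) :
    Summable (fun k : ℤ => exp (-π * (2 * (k : ℝ)) ^ 2 * t)) := by
  have h := (aux_summable ht).comp_injective (i := fun k : ℤ => 2 * k) (fun a b h => by simpa using h)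
  refine h.congr ?_
  intro k
  simp

open Real in
theorem aux_summable_odd {t : ℝ} (ht : 0 < t) :
    Summable (fun k : ℤ => exp (-π * (2 * (k : ℝ) + 1) ^ 2 * t)) := by
  have h := (aux_summable ht).comp_injective (i := fun k : ℤ => 2 * k + 1) (fun a b h => by simpa using h)
  refine h.congr ?_
  intro k
  simp

theorem aux_split {f : ℤ → ℝ} {a b : ℝ} (he : HasSum (fun k : ℤ => f (2 * k)) a)
    (ho : HasSum (fun k : ℤ => f (2 * k + 1)) b) : HasSum f (a + b) := by
  have h2 : Function.Injective (fun k : ℤ => 2 * k) := fun a b h => by simpa using h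
  have h3 : Function.Injective (fun k : ℤ => 2 * k + 1) := fun a b h => by simpa using h
  replace he := h2.hasSum_range_iff.2 he
  replace ho := h3.hasSum_range_iff.2 ho
  refine he.add_isCompl ?_ ho
  have h4 : Set.range (fun k : ℤ => 2 * k) = { n : ℤ | Even n } := by
    ext x
    exact ⟨fun ⟨y, h⟩ => even_iff_exists_two_mul.2 ⟨y, h.symm⟩,
      fun h => (even_iff_exists_two_mul.1 h).imp fun y h => h.symm⟩
  have h5 : Set.range (fun k : ℤ => 2 * k + 1) = { n : ℤ | Odd n } := by
    ext x
    exact ⟨fun ⟨y, h⟩ => ⟨y, h.symm⟩, fun ⟨y, h⟩ => ⟨y, h.symm⟩⟩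
  rw [h4, h5]
  exact Int.isCompl_even_odd

open Real in
theorem aux_theta4 {t : ℝ} (ht : 0 < t) : theta4 t = auxEV t - thetaO t := by
  unfold theta4
  rw [sub_eq_add_neg]
  refine (aux_split ?_ ?_).tsum_eq
  · refine (aux_summable_even ht).hasSum.congr_fun ?_
    intro k
    simp [zpow_mul]
  · refine ((aux_summable_odd ht).hasSum.neg).congr_fun ?_
    intro k
    simp [zpow_mul, zpow_add₀]

open Real in
theorem aux_theta3 {t : ℝ} (ht : 0 < t) :
    ∑' k : ℤ, exp (-π * t * (k : ℝ) ^ 2) = auxEV t + thetaO t := by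
  refine (aux_split ?_ ?_).tsum_eq
  · refine (aux_summable_even ht).hasSum.congr_fun ?_
    intro k
    push_cast; ring_nf
  · refine ((aux_summable_odd ht).hasSum).congr_fun ?_
    intro k
    push_cast; ring_nf

open Real in
theorem aux_EV (t : ℝ) : auxEV t = ∑' k : ℤ, exp (-π * (4 * t) * (k : ℝ) ^ 2) := by
  unfold auxEV
  congr 1; ext k; ring_nf

open Real in
theorem aux_modular {t : ℝ} (ht : 0 < t) : theta4 (1 / (4 * t)) = 2 * sqrt t * thetaO t := by
  have hB : 0 < 1 / (4 * t) := by positivity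
  have h1 := Real.tsum_exp_neg_mul_int_sq (a := 4 * t) (by positivity)
  have h2 := Real.tsum_exp_neg_mul_int_sq (a := t) ht
  have e1 : ∑' k : ℤ, exp (-π / (4 * t) * (k : ℝ) ^ 2) = auxEV (1 / (4 * t)) + thetaO (1 / (4 * t)) := by
    rw [← aux_theta3 hB]; congr 1; ext k; congr 1; ring
  have e2 : ∑' k : ℤ, exp (-π / t * (k : ℝ) ^ 2) = auxEV (1 / (4 * t)) := by
    rw [aux_EV]; congr 1; ext k; congr 1; field_simp
  rw [← aux_EV, e1, ← Real.sqrt_eq_rpow] at h1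
  rw [aux_theta3 ht, e2, ← Real.sqrt_eq_rpow] at h2
  rw [aux_theta4 hB]
  have h4 : sqrt (4 * t) = 2 * sqrt t := by
    rw [Real.sqrt_mul (by norm_num), show (4 : ℝ) = 2 ^ 2 by norm_num, Real.sqrt_sq (by norm_num)]
  rw [h4] at h1
  have hs : 0 < sqrt t := Real.sqrt_pos.2 ht
  field_simp at h1 h2
  linarith

open Real in
theorem aux_tail_odd {t : ℝ} (ht : 0 < t) (hy : exp (-π * t) ≤ 0.21) :
    Summable (fun k : ℤ => (2 * (k : ℝ) + 1) ^ 2 * exp (-π * (2 * (k : ℝ) + 1) ^ 2 * t)) ∧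
    ∑' k : ℤ, (2 * (k : ℝ) + 1) ^ 2 * exp (-π * (2 * (k : ℝ) + 1) ^ 2 * t) ≤ 2.1 * exp (-π * t) := by
  set y := exp (-π * t) with hyd
  have y0 : 0 < y := exp_pos _
  set f : ℤ → ℝ := fun k : ℤ => (2 * (k : ℝ) + 1) ^ 2 * exp (-π * (2 * (k : ℝ) + 1) ^ 2 * t) with hf
  have hy8 : 9 * y ^ 8 ≤ 1 / 1000 := by
    have : y ^ 8 ≤ 0.21 ^ 8 := by gcongr
    norm_num at this ⊢; linarith
  have hg := (hasSum_geometric_of_lt_one (r := 9 * y ^ 8) (by positivity) (by linarith)).mul_left y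
  have hpt : ∀ n : ℕ, f n ≤ y * (9 * y ^ 8) ^ n := by
    intro n
    have e : exp (-π * (2 * ((n : ℤ) : ℝ) + 1) ^ 2 * t) = y ^ ((2 * n + 1) ^ 2) := by
      rw [hyd, ← exp_nat_mul]; congr 1; push_cast; ring
    simp only [hf, e]
    have h9 : (2 * (n : ℝ) + 1) ^ 2 ≤ 9 ^ n := by
      have := one_add_mul_le_pow (a := (2 : ℝ)) (by norm_num) n
      have e9 : (9 : ℝ) ^ n = ((1 + 2) ^ n) ^ 2 := by rw [← pow_mul, mul_comm, pow_mul]; norm_num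
      rw [e9]
      gcongr; linarith
    have hp : y ^ ((2 * n + 1) ^ 2) ≤ y ^ (1 + 8 * n) := by
      apply pow_le_pow_of_le_one y0.le (by linarith)
      rcases n with _ | n
      · simp
      · ring_nf; nlinarith [sq_nonneg n]
    have := mul_le_mul h9 hp (by positivity) (by positivity)
    rw [Int.cast_natCast]
    refine le_trans this (le_of_eq ?_)
    rw [mul_pow, pow_add, pow_mul]; ring
  have hneg : ∀ n : ℕ, f (-(n + 1)) = f n := by
    intro n
    simp only [hf]; push_cast
    rw [show (2 * (-((n : ℝ) + 1)) + 1) = -(2 * (n : ℝ) + 1) by ring, neg_sq]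
  have h0 : ∀ k, 0 ≤ f k := fun k => by simp only [hf]; positivity
  have hs1 : Summable (fun n : ℕ => f n) := Summable.of_nonneg_of_le (fun n => h0 _) hpt hg.summable
  have hs2 : Summable (fun n : ℕ => f (-(n + 1))) := by simpa only [hneg] using hs1
  refine ⟨Summable.of_nat_of_neg_add_one hs1 hs2, ?_⟩
  rw [tsum_of_nat_of_neg_add_one hs1 hs2]
  simp only [hneg]
  have hle := hs1.tsum_le_tsum hpt hg.summable
  rw [hg.tsum_eq] at hle
  have : (1 - 9 * y ^ 8)⁻¹ ≤ 1.05 := by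
    rw [inv_le_comm₀ (by linarith) (by norm_num)]; norm_num at *; linarith
  have : y * (1 - 9 * y ^ 8)⁻¹ ≤ y * 1.05 := by gcongr
  linarith

open Real in
theorem aux_tail_even {t : ℝ} (ht : 0 < t) (hy : exp (-π * t) ≤ 0.21) :
    Summable (fun k : ℤ => ((2 * (k : ℝ)) ^ 2) ^ 2 * exp (-π * (2 * (k : ℝ)) ^ 2 * t)) ∧
    ∑' k : ℤ, ((2 * (k : ℝ)) ^ 2) ^ 2 * exp (-π * (2 * (k : ℝ)) ^ 2 * t) ≤ 34 * exp (-π * t) ^ 4 := by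
  set y := exp (-π * t) with hyd
  have y0 : 0 < y := exp_pos _
  set f : ℤ → ℝ := fun k : ℤ => ((2 * (k : ℝ)) ^ 2) ^ 2 * exp (-π * (2 * (k : ℝ)) ^ 2 * t) with hf
  have hy8 : 16 * y ^ 12 ≤ 1 / 1000 := by
    have : y ^ 12 ≤ 0.21 ^ 12 := by gcongr
    norm_num at this ⊢; linarith
  have hg := (hasSum_geometric_of_lt_one (r := 16 * y ^ 12) (by positivity) (by linarith)).mul_left (16 * y ^ 4)
  have hpt : ∀ n : ℕ, f (n + 1) ≤ 16 * y ^ 4 * (16 * y ^ 12) ^ n := by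
    intro n
    have e : exp (-π * (2 * (((n + 1 : ℤ)) : ℝ)) ^ 2 * t) = y ^ (4 * (n + 1) ^ 2) := by
      rw [hyd, ← exp_nat_mul]; congr 1; push_cast; ring
    simp only [hf, e]
    have h9 : ((2 * ((n + 1 : ℤ) : ℝ)) ^ 2) ^ 2 ≤ 16 * 16 ^ n := by
      have := one_add_mul_le_pow (a := (1 : ℝ)) (by norm_num) n
      have e9 : (16 : ℝ) ^ n = ((1 + 1) ^ n) ^ 4 := by rw [← pow_mul, mul_comm, pow_mul]; norm_num
      rw [e9]
      have : ((n : ℝ) + 1) ^ 4 ≤ ((1 + 1) ^ n) ^ 4 := by gcongr; linarith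
      push_cast
      nlinarith
    have hp : y ^ (4 * (n + 1) ^ 2) ≤ y ^ (4 + 12 * n) := by
      apply pow_le_pow_of_le_one y0.le (by linarith)
      rcases n with _ | n
      · simp
      · ring_nf; nlinarith [sq_nonneg n]
    have := mul_le_mul h9 hp (by positivity) (by positivity)
    refine le_trans this (le_of_eq ?_)
    rw [mul_pow, pow_add, pow_mul]; ring
  have hneg : ∀ n : ℕ, f (-(n + 1)) = f (n + 1) := by
    intro n
    simp only [hf]; push_cast
    ring_nf
  have h0 : ∀ k, 0 ≤ f k := fun k => by simp only [hf]; positivity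
  have hs1 : Summable (fun n : ℕ => f (n + 1)) := Summable.of_nonneg_of_le (fun n => h0 _) hpt hg.summable
  have hs2 : Summable (fun n : ℕ => f (-(n + 1))) := by simpa only [hneg] using hs1
  refine ⟨Summable.of_add_one_of_neg_add_one hs1 hs2, ?_⟩
  rw [tsum_of_add_one_of_neg_add_one hs1 hs2]
  simp only [hneg]
  have f0 : f 0 = 0 := by simp [hf]
  have hle := hs1.tsum_le_tsum hpt hg.summable
  rw [hg.tsum_eq] at hle
  have : (1 - 16 * y ^ 12)⁻¹ ≤ 17 / 16 := by
    rw [inv_le_comm₀ (by linarith) (by norm_num)]; norm_num at *; linarith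
  have : 16 * y ^ 4 * (1 - 16 * y ^ 12)⁻¹ ≤ 16 * y ^ 4 * (17 / 16) := by gcongr
  rw [f0]
  linarith

open Real in
theorem aux_thetaO_le {t : ℝ} (ht : 0 < t) (hy : exp (-π * t) ≤ 0.21) :
    thetaO t ≤ 2.1 * exp (-π * t) := by
  obtain ⟨hs, hle⟩ := aux_tail_odd ht hy
  refine le_trans ?_ hle
  refine (aux_summable_odd ht).tsum_le_tsum ?_ hs
  intro k
  have : (1 : ℝ) ≤ (2 * (k : ℝ) + 1) ^ 2 := by
    have : (1 : ℤ) ≤ (2 * k + 1) ^ 2 := by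
      have : 2 * k + 1 ≠ 0 := by omega
      have := sq_pos_of_ne_zero this
      omega
    exact_mod_cast this
  have h := exp_pos (-π * (2 * (k : ℝ) + 1) ^ 2 * t)
  nlinarith

open Real in
theorem aux_thetaO_nonneg (t : ℝ) : 0 ≤ thetaO t := tsum_nonneg fun k => (exp_pos _).le

open Real in
theorem aux_EV_le {t : ℝ} (ht : 0 < t) (hy : exp (-π * t) ≤ 0.21) :
    auxEV t ≤ 1 + 3 * exp (-π * t) ^ 4 := by
  obtain ⟨hs, hle⟩ := aux_tail_even ht hy
  have h1 : HasSum (fun k : ℤ => if k = 0 then (1 : ℝ) else 0) 1 := hasSum_ite_eq 0 1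
  have h2 := h1.add (hs.hasSum.mul_left (1 / 16))
  have := hasSum_le (f := fun k : ℤ => exp (-π * (2 * (k : ℝ)) ^ 2 * t)) ?_ (aux_summable_even ht).hasSum h2
  · have h4 : 0 < exp (-π * t) ^ 4 := by positivity
    have e : auxEV t = ∑' k : ℤ, exp (-π * (2 * (k : ℝ)) ^ 2 * t) := rfl
    rw [e]; linarith
  intro k
  by_cases hk : k = 0
  · simp [hk]
  · simp only [hk, if_false, zero_add]
    have : (1 : ℝ) ≤ (k : ℝ) ^ 2 := by
      have : (1 : ℤ) ≤ k ^ 2 := by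
        have := sq_pos_of_ne_zero hk
        omega
      exact_mod_cast this
    have h := exp_pos (-π * (2 * (k : ℝ)) ^ 2 * t)
    have h4 : (1 : ℝ) ≤ (k : ℝ) ^ 4 := by nlinarith
    nlinarith

open Real in
theorem aux_EV_ge {t : ℝ} (ht : 0 < t) : 1 ≤ auxEV t := by
  have := (aux_summable_even ht).le_tsum 0 (fun k _ => (exp_pos _).le)
  simpa [auxEV] using this

open Real in
theorem aux_lower {c s : ℝ} (hc : 3 ≤ c) (hs : 1 ≤ s) :
    (2 / 3) * (exp (-(c / s)) * (1 - exp (-(c - c / s))) ^ 2) ≤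
      exp (-(c * s)) + exp (-(c / s)) - 2 * exp (-c) := by
  have hs0 : 0 < s := by linarith
  obtain ⟨β, hβ⟩ : ∃ β, β = 1 - 1 / s := ⟨_, rfl⟩
  have hb1 : 1 - β = 1 / s := by linarith
  have hbpos : 0 < 1 - β := by rw [hb1]; positivity
  have hb0 : 0 ≤ β := by
    have : 1 / s ≤ 1 := by rw [div_le_one hs0]; exact hs
    linarith
  have hB : c / s = c - c * β := by rw [div_eq_mul_one_div, ← hb1]; ring
  have hA : c * s = c + c * β + c * β ^ 2 / (1 - β) := by
    have : s = 1 / (1 - β) := by rw [hb1]; field_simp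
    rw [this]; field_simp; ring
  obtain ⟨w, hw⟩ : ∃ w, w = c * β ^ 2 / (1 - β) := ⟨_, rfl⟩
  rw [← hw] at hA
  have hw0 : 0 ≤ w := by rw [hw]; positivity
  set E := exp (c * β) with hE
  have E0 : 0 < E := exp_pos _
  have e1 : exp (-(c / s)) = exp (-c) * E := by rw [hB, hE, ← exp_add]; congr 1; ring
  have e2 : exp (-(c - c / s)) = E⁻¹ := by rw [hB, hE, ← exp_neg]; congr 1; ring
  have e3 : exp (-(c * s)) = exp (-c) * (E⁻¹ * exp (-w)) := by
    rw [hA, hE, ← exp_neg, ← exp_add, ← exp_add]; congr 1; ring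
  rw [e1, e2, e3]
  have hq := exp_pos (-c)
  -- D
  have hD : (c * β) ^ 2 ≤ E + E⁻¹ - 2 := by
    have h1 : c * β / 2 ≤ sinh (c * β / 2) := self_le_sinh_iff.2 (by positivity)
    have h2 : (c * β / 2) ^ 2 ≤ sinh (c * β / 2) ^ 2 := by gcongr
    have h3 := cosh_two_mul (c * β / 2)
    have h4 := cosh_sq (c * β / 2)
    rw [show 2 * (c * β / 2) = c * β by ring, cosh_eq, exp_neg, ← hE] at h3
    nlinarith
  have hkey : E⁻¹ * (1 - exp (-w)) ≤ c * β ^ 2 := by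
    have hEi : E⁻¹ ≤ 1 := by
      apply inv_le_one_of_one_le₀
      rw [hE]; exact one_le_exp (by positivity)
    have hEi0 : 0 < E⁻¹ := inv_pos.2 E0
    have hwpos := exp_pos (-w)
    have hw1 := one_sub_le_exp_neg w
    have hwle : exp (-w) ≤ 1 := exp_le_one_iff.2 (by linarith)
    by_cases hb : 2 / 3 ≤ β
    · have : E⁻¹ * (1 - exp (-w)) ≤ 1 * 1 := by
        apply mul_le_mul hEi (by linarith) (by linarith) (by norm_num)
      nlinarith
    · push Not at hb
      have h1 : E⁻¹ ≤ 1 - β := by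
        rw [inv_le_comm₀ E0 hbpos]
        have : 1 + c * β ≤ E := by rw [hE]; linarith [add_one_le_exp (c * β)]
        refine le_trans ?_ this
        rw [inv_le_iff_one_le_mul₀ hbpos]
        nlinarith [mul_nonneg hb0 (sub_nonneg.2 hc), mul_nonneg (mul_nonneg hb0 (sub_nonneg.2 hc)) hbpos.le]
      calc E⁻¹ * (1 - exp (-w)) ≤ (1 - β) * w := by
            apply mul_le_mul h1 (by linarith) (by linarith) hbpos.le
        _ = c * β ^ 2 := by rw [hw]; field_simp
  have hmain : E⁻¹ * (1 - exp (-w)) ≤ (E + E⁻¹ - 2) / 3 := by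
    have : 3 * (c * β ^ 2) ≤ (c * β) ^ 2 := by nlinarith [mul_nonneg (sub_nonneg.2 hc) (mul_nonneg (by linarith : 0 ≤ c) (sq_nonneg β))]
    linarith
  have id1 : E * (1 - E⁻¹) ^ 2 = E + E⁻¹ - 2 := by field_simp; ring
  calc (2 / 3) * (exp (-c) * E * (1 - E⁻¹) ^ 2) = exp (-c) * ((2 / 3) * (E + E⁻¹ - 2)) := by rw [← id1]; ring
    _ ≤ exp (-c) * (E⁻¹ * exp (-w) + E - 2) := by
        apply mul_le_mul_of_nonneg_left _ hq.le
        nlinarith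
    _ = _ := by ring

open Real in
theorem aux_w {c s : ℝ} (hc : 3 ≤ c) (hs : 1 ≤ s) (h : 3 / 2 ≤ c / s) :
    exp (-c) * (c * s + c / s - 2 * c) / 2 ≤
      (1 / 3) * (exp (-(c / s)) * (1 - exp (-(c - c / s))) ^ 2) := by
  have hs0 : 0 < s := by linarith
  have hd0 : 0 ≤ c - c / s := by
    have : c / s ≤ c := div_le_self (by linarith) hs
    linarith
  obtain ⟨δ, hδ⟩ : ∃ δ, δ = c - c / s := ⟨_, rfl⟩
  rw [← hδ] at hd0 ⊢
  have e1 : exp (-(c / s)) = exp (-c) * exp δ := by rw [← exp_add]; congr 1; linarith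
  have hD : δ ^ 2 ≤ exp δ * (1 - exp (-δ)) ^ 2 := by
    have h1 : δ / 2 ≤ sinh (δ / 2) := self_le_sinh_iff.2 (by positivity)
    have h2 : (δ / 2) ^ 2 ≤ sinh (δ / 2) ^ 2 := by gcongr
    have h3 := cosh_two_mul (δ / 2)
    have h4 := cosh_sq (δ / 2)
    rw [show 2 * (δ / 2) = δ by ring, cosh_eq, exp_neg] at h3
    have id1 : exp δ * (1 - (exp δ)⁻¹) ^ 2 = exp δ + (exp δ)⁻¹ - 2 := by
      have := exp_pos δ
      field_simp; ring
    rw [exp_neg, id1]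
    nlinarith
  have hw : (c * s + c / s - 2 * c) / 2 ≤ (1 / 3) * δ ^ 2 := by
    have h5 : c * s + c / s - 2 * c = δ ^ 2 * (s / c) := by
      rw [hδ]; field_simp; ring
    have h6 : s / c ≤ 2 / 3 := by
      rw [div_le_div_iff₀ (by linarith) (by norm_num)]
      rw [le_div_iff₀ hs0] at h
      linarith
    rw [h5]
    nlinarith [mul_le_mul_of_nonneg_left h6 (sq_nonneg δ)]
  rw [e1]
  have hq := exp_pos (-c)
  have := mul_le_mul_of_nonneg_left (hw.trans (mul_le_mul_of_nonneg_left hD (by norm_num : (0:ℝ) ≤ 1/3))) hq.le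
  linarith

open Real in
theorem aux_upper {c s a : ℝ} (hc : 0 < c) (hs : 1 ≤ s) (ha : 1 ≤ a) :
    exp (-(a * c * s)) + exp (-(a * c / s)) - 2 * exp (-(a * c)) ≤
      a ^ 2 * exp (-(a * c / s)) * (1 - exp (-(c - c / s))) ^ 2 := by
  have hs0 : 0 < s := by linarith
  have hd0 : 0 ≤ c - c / s := by
    have : c / s ≤ c := div_le_self (by linarith) hs
    linarith
  obtain ⟨δ, hδ⟩ : ∃ δ, δ = c - c / s := ⟨_, rfl⟩
  rw [← hδ] at hd0 ⊢
  have hBe : a * c / s = a * c - a * δ := by rw [hδ]; ring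
  have hAe : a * c + a * δ ≤ a * c * s := by
    have : c * s + c / s - 2 * c = c * (s - 1) ^ 2 / s := by field_simp; ring
    have h0 : 0 ≤ c * (s - 1) ^ 2 / s := by positivity
    have : c + δ ≤ c * s := by linarith
    nlinarith
  have hx : exp (-(a * c * s)) ≤ exp (-(a * c)) * exp (-(a * δ)) := by
    rw [← exp_add]; apply exp_le_exp.2; linarith
  have hq : exp (-(a * c)) = exp (-(a * c / s)) * exp (-(a * δ)) := by
    rw [← exp_add]; congr 1; linarith
  have hb : 1 - exp (-(a * δ)) ≤ a * (1 - exp (-δ)) := by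
    have := one_add_mul_self_le_rpow_one_add (s := exp (-δ) - 1) (by linarith [exp_pos (-δ)]) ha
    rw [show 1 + (exp (-δ) - 1) = exp (-δ) by ring, ← exp_mul] at this
    rw [show -(a * δ) = -δ * a by ring]
    linarith
  have hb0 : 0 ≤ 1 - exp (-(a * δ)) := by
    have : exp (-(a * δ)) ≤ 1 := exp_le_one_iff.2 (by nlinarith)
    linarith
  have hb2 : (1 - exp (-(a * δ))) ^ 2 ≤ (a * (1 - exp (-δ))) ^ 2 := by gcongr
  have hy := exp_pos (-(a * c / s))
  have := mul_le_mul_of_nonneg_left hb2 hy.le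
  rw [hq] at hx ⊢
  nlinarith

open Real in
theorem aux_cs {A B : ℝ} (hA : 0 < A) (hB : 0 < B) :
    thetaO ((A + B) / 2) ^ 2 ≤ thetaO A * thetaO B := by
  have h2 : Real.HolderConjugate 2 2 := by constructor <;> norm_num
  have sq : ∀ t : ℝ, ∀ k : ℤ, exp (-π * (2 * (k : ℝ) + 1) ^ 2 * (t / 2)) ^ (2 : ℝ) =
      exp (-π * (2 * (k : ℝ) + 1) ^ 2 * t) := by
    intro t k
    rw [← exp_mul]; congr 1; ring
  have h := Real.inner_le_Lp_mul_Lq_tsum_of_nonneg (ι := ℤ)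
    (f := fun k => exp (-π * (2 * (k : ℝ) + 1) ^ 2 * (A / 2)))
    (g := fun k => exp (-π * (2 * (k : ℝ) + 1) ^ 2 * (B / 2))) h2
    (fun k => (exp_pos _).le) (fun k => (exp_pos _).le)
    ((aux_summable_odd hA).congr fun k => by rw [sq])
    ((aux_summable_odd hB).congr fun k => by rw [sq])
  simp only [sq, ← exp_add] at h
  rw [← Real.sqrt_eq_rpow, ← Real.sqrt_eq_rpow] at h
  have e : ∑' k : ℤ, exp (-π * (2 * (k : ℝ) + 1) ^ 2 * (A / 2) + -π * (2 * (k : ℝ) + 1) ^ 2 * (B / 2)) =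
      thetaO ((A + B) / 2) := by
    unfold thetaO; congr 1; ext k; congr 1; ring
  rw [e] at h
  change _ ≤ sqrt (thetaO A) * sqrt (thetaO B) at h
  have h3 := pow_le_pow_left₀ (aux_thetaO_nonneg _) h 2
  rwa [mul_pow, Real.sq_sqrt (aux_thetaO_nonneg _), Real.sq_sqrt (aux_thetaO_nonneg _)] at h3

open Real in
theorem aux_diff {r w : ℝ} (hr : 0 < r) (hw : 0 ≤ w) (hy : exp (-π * r) ≤ 0.21) :
    thetaO r - thetaO (r + w) ≤ π * w * (2.1 * exp (-π * r)) := by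
  obtain ⟨hs, hle⟩ := aux_tail_odd hr hy
  have h1 := (aux_summable_odd hr).hasSum.sub (aux_summable_odd (t := r + w) (by linarith)).hasSum
  have h2 := hasSum_le ?_ h1 (hs.hasSum.mul_left (π * w))
  · refine le_trans h2 ?_
    have : 0 ≤ π * w := by positivity
    gcongr
  intro k
  have e : exp (-π * (2 * (k : ℝ) + 1) ^ 2 * (r + w)) = exp (-π * (2 * (k : ℝ) + 1) ^ 2 * r) *
    exp (-(π * w * (2 * (k : ℝ) + 1) ^ 2)) := by
    rw [← exp_add]; congr 1; ring
  rw [e]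
  have h3 := one_sub_le_exp_neg (π * w * (2 * (k : ℝ) + 1) ^ 2)
  have h4 := exp_pos (-π * (2 * (k : ℝ) + 1) ^ 2 * r)
  nlinarith

open Real in
theorem aux_num1 {t : ℝ} (ht : 1 / 2 ≤ t) : exp (-π * t) ≤ 0.21 := by
  have hpi := pi_gt_d4
  have h1 : exp (-π * t) ≤ exp (-1) * exp (-(0.57)) := by
    rw [← exp_add]; apply exp_le_exp.2; norm_num at *; nlinarith
  have h2 := exp_neg_one_lt_d9
  have h3 : exp (-(0.57 : ℝ)) ≤ 0.57 := by
    rw [exp_neg, inv_le_comm₀ (exp_pos _) (by norm_num)]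
    refine le_trans ?_ (sum_le_exp_of_nonneg (x := 0.57) (by norm_num) 4)
    norm_num [Finset.sum_range_succ, Nat.factorial]
  have h4 := exp_pos (-(0.57 : ℝ))
  nlinarith

open Real in
theorem aux_num2 {t : ℝ} (ht : 1 ≤ t) : exp (-π * t) ≤ 0.0441 := by
  have h := aux_num1 (t := t / 2) (by linarith)
  have e : exp (-π * t) = exp (-π * (t / 2)) ^ 2 := by
    rw [← exp_nat_mul]; congr 1; push_cast; ring
  rw [e]
  have := exp_pos (-π * (t / 2))
  nlinarith

open Real in
theorem aux_far {B : ℝ} (hB : 0 < B) (h : B ≤ 1 / 2) : theta4 B ≤ 0.75 := by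
  obtain ⟨t, ht⟩ : ∃ t, t = 1 / (4 * B) := ⟨_, rfl⟩
  have ht2 : 1 / 2 ≤ t := by
    rw [ht, div_le_div_iff₀ (by norm_num) (by positivity)]; linarith
  have ht0 : 0 < t := by linarith
  have hBt : B = 1 / (4 * t) := by rw [ht]; field_simp
  rw [hBt, aux_modular ht0]
  have h1 := aux_thetaO_le ht0 (aux_num1 ht2)
  have h2 : sqrt t ≤ t + 1 / 4 := by
    nlinarith [Real.sq_sqrt ht0.le, sq_nonneg (sqrt t - 1 / 2)]
  have h3 : exp (-π * t) * (3 * t - 1 / 2) ≤ 0.21 := by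
    have e : exp (-π * t) = exp (-π * (1 / 2)) * exp (-(π * (t - 1 / 2))) := by
      rw [← exp_add]; congr 1; ring
    have h5 := aux_num1 (t := 1 / 2) le_rfl
    have h6 : exp (-(π * (t - 1 / 2))) * (3 * t - 1 / 2) ≤ 1 := by
      rw [exp_neg, inv_mul_le_iff₀ (exp_pos _)]
      have := add_one_le_exp (π * (t - 1 / 2))
      have := pi_gt_three
      nlinarith
    rw [e, mul_assoc]
    have := exp_pos (-π * (1 / 2))
    nlinarith
  have hs := Real.sqrt_nonneg t
  have h0 := aux_thetaO_nonneg t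
  have hy := exp_pos (-π * t)
  calc 2 * sqrt t * thetaO t ≤ 2 * (t + 1 / 4) * (2.1 * exp (-π * t)) := by gcongr
    _ ≤ 2 * (0.75 * (3 * t - 1 / 2)) * (2.1 * exp (-π * t)) := by
        gcongr; linarith
    _ ≤ _ := by nlinarith

set_option maxHeartbeats 1000000 in
open Real in
theorem aux_near {r s : ℝ} (hr : 1 ≤ r) (hs : 1 ≤ s) (h : 1 / 2 ≤ r / s) :
    theta4 (r * s) * theta4 (r / s) - 2 * thetaO (r * s) * thetaO (r / s) ≤
        theta4 r ^ 2 - 2 * thetaO r ^ 2 := by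
  have hs0 : 0 < s := by linarith
  have hr0 : 0 < r := by linarith
  have hA0 : 0 < r * s := by positivity
  have hB0 : 0 < r / s := by positivity
  have hA1 : 1 ≤ r * s := by nlinarith
  have hpi := pi_gt_three
  have hc : 3 ≤ π * r := by nlinarith
  obtain ⟨N, hN⟩ : ∃ N, N = exp (-(π * r / s)) * (1 - exp (-(π * r - π * r / s))) ^ 2 := ⟨_, rfl⟩
  have hN0 : 0 ≤ N := by rw [hN]; have := exp_pos (-(π * r / s)); positivity
  have hyB := aux_num1 h
  have hyA := aux_num2 hA1
  have hyr := aux_num2 hr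
  -- odd part
  have hodd : 4 / 3 * N ≤ thetaO (r * s) + thetaO (r / s) - 2 * thetaO r := by
    have hS := ((aux_summable_odd hA0).hasSum.add (aux_summable_odd hB0).hasSum).sub
      ((aux_summable_odd hr0).hasSum.mul_left 2)
    have hL : ∀ k : ℤ, 0 ≤ exp (-π * (2 * (k : ℝ) + 1) ^ 2 * (r * s)) +
        exp (-π * (2 * (k : ℝ) + 1) ^ 2 * (r / s)) - 2 * exp (-π * (2 * (k : ℝ) + 1) ^ 2 * r) := by
      intro k
      have h1 : (1 : ℝ) ≤ (2 * (k : ℝ) + 1) ^ 2 := by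
        have : (1 : ℤ) ≤ (2 * k + 1) ^ 2 := by
          have : 2 * k + 1 ≠ 0 := by omega
          have := sq_pos_of_ne_zero this
          omega
        exact_mod_cast this
      have h2 := aux_lower (c := (2 * (k : ℝ) + 1) ^ 2 * (π * r)) (s := s) (by nlinarith) hs
      have h3 : 0 ≤ (2 / 3) * (exp (-((2 * (k : ℝ) + 1) ^ 2 * (π * r) / s)) *
        (1 - exp (-((2 * (k : ℝ) + 1) ^ 2 * (π * r) - (2 * (k : ℝ) + 1) ^ 2 * (π * r) / s))) ^ 2) := by
        positivity
      have h4 := h3.trans h2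
      have e1 : -π * (2 * (k : ℝ) + 1) ^ 2 * (r * s) = -((2 * (k : ℝ) + 1) ^ 2 * (π * r) * s) := by ring
      have e2 : -π * (2 * (k : ℝ) + 1) ^ 2 * (r / s) = -((2 * (k : ℝ) + 1) ^ 2 * (π * r) / s) := by ring
      have e3 : -π * (2 * (k : ℝ) + 1) ^ 2 * r = -((2 * (k : ℝ) + 1) ^ 2 * (π * r)) := by ring
      rw [e1, e2, e3]
      exact h4
    have h5 := sum_le_hasSum ({0, -1} : Finset ℤ) (fun k _ => hL k) hS
    have h6 := aux_lower hc hs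
    rw [← hN] at h6
    rw [Finset.sum_pair (by norm_num)] at h5
    push_cast at h5
    have e1 : -π * (2 * 0 + 1) ^ 2 * (r * s) = -(π * r * s) := by ring
    have e2 : -π * (2 * 0 + 1) ^ 2 * (r / s) = -(π * r / s) := by ring
    have e3 : -π * (2 * 0 + 1) ^ 2 * r = -(π * r) := by ring
    have e4 : -π * (2 * -1 + 1) ^ 2 * (r * s) = -(π * r * s) := by ring
    have e5 : -π * (2 * -1 + 1) ^ 2 * (r / s) = -(π * r / s) := by ring
    have e6 : -π * (2 * -1 + 1) ^ 2 * r = -(π * r) := by ring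
    rw [e1, e2, e3, e4, e5, e6] at h5
    change _ ≤ thetaO (r * s) + thetaO (r / s) - 2 * thetaO r at h5
    linarith
  have heven : auxEV (r * s) + auxEV (r / s) - 2 * auxEV r ≤ 0.32 * N := by
    obtain ⟨hsum, hle⟩ := aux_tail_even hB0 hyB
    have hS := ((aux_summable_even hA0).hasSum.add (aux_summable_even hB0).hasSum).sub
      ((aux_summable_even hr0).hasSum.mul_left 2)
    have hR := hsum.hasSum.mul_right ((1 - exp (-(π * r - π * r / s))) ^ 2)
    have hcmp := hasSum_le ?_ hS hR
    · change auxEV (r * s) + auxEV (r / s) - 2 * auxEV r ≤ _ at hcmp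
      refine hcmp.trans ?_
      have eB : exp (-(π * r / s)) = exp (-π * (r / s)) := by congr 1; ring
      rw [eB] at hN
      set y := exp (-π * (r / s))
      set K := (1 - exp (-(π * r - π * r / s))) ^ 2
      have hy0 : 0 < y := exp_pos _
      have hK : 0 ≤ K := sq_nonneg _
      have hy3 : y ^ 3 ≤ 0.21 ^ 3 := by gcongr
      calc _ ≤ 34 * y ^ 4 * K := by gcongr
        _ = 34 * y ^ 3 * N := by rw [hN]; ring
        _ ≤ 0.32 * N := by
          apply mul_le_mul_of_nonneg_right _ hN0
          norm_num at hy3 ⊢; linarith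
    · intro k
      by_cases hk : k = 0
      · simp [hk]; norm_num
      · have h1 : (1 : ℝ) ≤ (2 * (k : ℝ)) ^ 2 := by
          have : (1 : ℤ) ≤ (2 * k) ^ 2 := by
            have : 2 * k ≠ 0 := by omega
            have := sq_pos_of_ne_zero this
            omega
          exact_mod_cast this
        have h2 := aux_upper (c := π * r) (s := s) (a := (2 * (k : ℝ)) ^ 2) (by linarith) hs h1
        have e1 : -π * (2 * (k : ℝ)) ^ 2 * (r * s) = -((2 * (k : ℝ)) ^ 2 * (π * r) * s) := by ring
        have e2 : -π * (2 * (k : ℝ)) ^ 2 * (r / s) = -((2 * (k : ℝ)) ^ 2 * (π * r) / s) := by ring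
        have e3 : -π * (2 * (k : ℝ)) ^ 2 * r = -((2 * (k : ℝ)) ^ 2 * (π * r)) := by ring
        simp only [e1, e2, e3]
        exact h2
  -- w part
  have hoo : thetaO r ^ 2 - thetaO (r * s) * thetaO (r / s) ≤ 0.15 * N := by
    have hcs := aux_cs hA0 hB0
    obtain ⟨w, hw⟩ : ∃ w, w = (r * s + r / s) / 2 - r := ⟨_, rfl⟩
    have hw0 : 0 ≤ w := by
      have : w = r * (s - 1) ^ 2 / (2 * s) := by rw [hw]; field_simp; ring
      rw [this]; positivity
    rw [show (r * s + r / s) / 2 = r + w by rw [hw]; ring] at hcs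
    have hd := aux_diff hr0 hw0 (by linarith)
    have hww := aux_w hc hs (by
      have : π * r / s = π * (r / s) := by ring
      rw [this]; nlinarith)
    rw [← hN, show exp (-(π * r)) * (π * r * s + π * r / s - 2 * (π * r)) / 2 =
      exp (-π * r) * (π * w) by rw [hw, show -(π * r) = -π * r by ring]; ring] at hww
    have hro := aux_thetaO_le hr0 (by linarith)
    have h1 := aux_thetaO_nonneg r
    have h2 := aux_thetaO_nonneg (r + w)
    have hq := exp_pos (-π * r)
    have hpw : 0 ≤ π * w := by positivity
    set q := exp (-π * r)
    have hd' : thetaO r - thetaO (r + w) ≤ 0.7 * N := by nlinarith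
    by_cases hsgn : thetaO (r + w) ≤ thetaO r
    · have h3 : (thetaO r + thetaO (r + w)) ≤ 0.186 := by linarith
      have h4 : (thetaO r - thetaO (r + w)) * (thetaO r + thetaO (r + w)) ≤ 0.7 * N * 0.186 := by
        apply mul_le_mul hd' h3 (by linarith) (by linarith)
      nlinarith
    · push Not at hsgn
      nlinarith
  have ho_r := aux_thetaO_le hr0 (by linarith)
  have ho_A := aux_thetaO_le hA0 (by linarith)
  have ho_B := aux_thetaO_le hB0 hyB
  have hE_r := aux_EV_le hr0 (by linarith)
  have hE_r1 := aux_EV_ge hr0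
  have hE_A1 := aux_EV_ge hA0
  have hE_B1 := aux_EV_ge hB0
  have hO0 := aux_thetaO_nonneg r
  have hq4 : exp (-π * r) ^ 4 ≤ 0.001 := by
    have : exp (-π * r) ^ 4 ≤ 0.0441 ^ 4 := by gcongr
    refine this.trans (by norm_num)
  rw [aux_theta4 hA0, aux_theta4 hB0, aux_theta4 hr0]
  obtain ⟨TA, hTA⟩ : ∃ z, z = auxEV (r * s) - thetaO (r * s) := ⟨_, rfl⟩
  obtain ⟨TB, hTB⟩ : ∃ z, z = auxEV (r / s) - thetaO (r / s) := ⟨_, rfl⟩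
  obtain ⟨T, hT⟩ : ∃ z, z = auxEV r - thetaO r := ⟨_, rfl⟩
  rw [← hTA, ← hTB, ← hT]
  obtain ⟨P, hP⟩ : ∃ z, z = 2 * T - TA - TB := ⟨_, rfl⟩
  have hP1 : 1.01 * N ≤ P := by rw [hP, hTA, hTB, hT]; linarith
  have hP2 : P ≤ 0.6 := by rw [hP, hTA, hTB, hT]; linarith
  have hT1 : 0.9 ≤ T := by rw [hT]; linarith
  have hP0 : 0 ≤ P := by linarith
  have hprod : TA * TB ≤ (T - P / 2) ^ 2 := by
    have : T - P / 2 = (TA + TB) / 2 := by rw [hP]; ring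
    rw [this]; nlinarith [sq_nonneg (TA - TB)]
  have h7 : 0.75 * P ≤ T * P - P ^ 2 / 4 := by
    have h8 := mul_nonneg hP0 (sub_nonneg.2 hT1)
    have h9 := mul_nonneg hP0 (sub_nonneg.2 hP2)
    linarith
  have h10 : (T - P / 2) ^ 2 = T ^ 2 - (T * P - P ^ 2 / 4) := by ring
  rw [h10] at hprod
  linarith

open Real in
theorem aux_ge {r s : ℝ} (hr : 1 ≤ r) (hs : 1 ≤ s) :
    theta4 (r * s) * theta4 (r / s) - 2 * thetaO (r * s) * thetaO (r / s) ≤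
        theta4 r ^ 2 - 2 * thetaO r ^ 2 := by
  by_cases h : 1 / 2 ≤ r / s
  · exact aux_near hr hs h
  push Not at h
  have hs0 : 0 < s := by linarith
  have hr0 : 0 < r := by linarith
  have hA0 : 0 < r * s := by positivity
  have hB0 : 0 < r / s := by positivity
  have hA1 : 1 ≤ r * s := by nlinarith
  have hB := aux_far hB0 h.le
  have hyA := aux_num2 hA1
  have hyr := aux_num2 hr
  have ho_r := aux_thetaO_le hr0 (by linarith)
  have ho_A := aux_thetaO_le hA0 (by linarith)
  have hE_r1 := aux_EV_ge hr0
  have hE_A1 := aux_EV_ge hA0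
  have hE_A := aux_EV_le hA0 (by linarith)
  have h1 := aux_thetaO_nonneg r
  have h2 := aux_thetaO_nonneg (r * s)
  have h3 := aux_thetaO_nonneg (r / s)
  have hq4 : exp (-π * (r * s)) ^ 4 ≤ 0.001 := by
    have : exp (-π * (r * s)) ^ 4 ≤ 0.0441 ^ 4 := by gcongr
    refine this.trans (by norm_num)
  have hTA : theta4 (r * s) ≤ 1.003 := by rw [aux_theta4 hA0]; linarith
  have hTA0 : 0 ≤ theta4 (r * s) := by rw [aux_theta4 hA0]; linarith
  have hT : 0.907 ≤ theta4 r := by rw [aux_theta4 hr0]; linarith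
  have hO : thetaO r ≤ 0.093 := by linarith
  have h5 := mul_nonneg h2 h3
  have h6 : theta4 (r * s) * theta4 (r / s) ≤ 0.76 := by nlinarith
  nlinarith

theorem odd_redundancy_lower (r : ℝ) (hr : 1 ≤ r) :
    ∀ s > (0 : ℝ),
      theta4 (r * s) * theta4 (r / s) - 2 * thetaO (r * s) * thetaO (r / s) ≤
        theta4 r ^ 2 - 2 * thetaO r ^ 2 := by
  intro s hs
  rcases le_total 1 s with h | h
  · exact aux_ge hr h
  · have := aux_ge (s := 1 / s) hr (by rw [le_div_iff₀ hs]; linarith)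
    rw [show r * (1 / s) = r / s by ring, show r / (1 / s) = r * s by field_simp] at this
    linarith
end

section
/- For every x > 0, the Poisson-summation identity θₒ(x) = (1/(2√x)) · θ₄(1/(4x)) holds. -/
theorem thetaO_poisson (x : ℝ) (hx : 0 < x) :
    thetaO x = 1 / (2 * Real.sqrt x) * theta4 (1 / (4 * x)) := by
  have hs : 0 < Real.sqrt x := Real.sqrt_pos.mpr hx
  have ha : 0 < ((1 / (4 * x) : ℝ) : ℂ).re := by
    rw [Complex.ofReal_re]; positivity
  have hxc : (x : ℂ) ≠ 0 := by exact_mod_cast hx.ne'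
  have key := Complex.tsum_exp_neg_quadratic ha (-Complex.I / 2)
  have h1 : ∀ n : ℤ, Complex.exp (-Real.pi * ((1 / (4 * x) : ℝ) : ℂ) * n ^ 2
      + 2 * Real.pi * (-Complex.I / 2) * n) =
      (((-1 : ℝ) ^ n * Real.exp (-Real.pi * (n : ℝ) ^ 2 * (1 / (4 * x))) : ℝ) : ℂ) := by
    intro n
    have e : Complex.exp (2 * Real.pi * (-Complex.I / 2) * n) = (-1 : ℂ) ^ n := by
      have : Complex.exp (-(Real.pi * Complex.I)) = -1 := by
        rw [Complex.exp_neg, Complex.exp_pi_mul_I]; norm_num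
      rw [← this, ← Complex.exp_int_mul]
      congr 1; ring
    rw [Complex.exp_add, e]
    push_cast
    rw [mul_comm]
    congr 2; ring
  have h2 : ∀ n : ℤ, Complex.exp (-Real.pi / ((1 / (4 * x) : ℝ) : ℂ) *
      (n + Complex.I * (-Complex.I / 2)) ^ 2) =
      ((Real.exp (-Real.pi * (2 * (n : ℝ) + 1) ^ 2 * x) : ℝ) : ℂ) := by
    intro n
    have : Complex.I * (-Complex.I / 2) = 1 / 2 := by
      linear_combination (-1 / 2 : ℂ) * Complex.I_mul_I
    rw [this]
    push_cast
    congr 1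
    field_simp
    try ring
  have h3 : ((1 / (4 * x) : ℝ) : ℂ) ^ (1 / 2 : ℂ) = ((1 / (2 * Real.sqrt x) : ℝ) : ℂ) := by
    have : (1 / (4 * x) : ℝ) ^ (1 / 2 : ℝ) = 1 / (2 * Real.sqrt x) := by
      rw [← Real.sqrt_eq_rpow, show 1 / (4 * x) = (1 / (2 * Real.sqrt x)) ^ 2 by
        rw [div_pow, mul_pow, Real.sq_sqrt hx.le]; norm_num]
      exact Real.sqrt_sq (by positivity)
    rw [← this, Complex.ofReal_cpow (by positivity)]
    push_cast; rfl
  simp_rw [h1, h2] at key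
  rw [h3, ← Complex.ofReal_tsum, ← Complex.ofReal_tsum] at key
  have key2 : theta4 (1 / (4 * x)) = 1 / (1 / (2 * Real.sqrt x)) * thetaO x := by
    unfold theta4 thetaO
    exact_mod_cast key
  rw [key2]
  field_simp
end

section
/- The function s ↦ s · θₒ'(s)/θₒ(s) is strictly decreasing on the interval [1/4, ∞). -/
noncomputable def auxA (n : ℕ) : ℝ := 4 * n * (n + 1)

lemma auxA_nonneg (n : ℕ) : 0 ≤ auxA n := by unfold auxA; positivity

lemma aux_summable_s15 (j : ℕ) {r : ℝ} (hr : 0 < r) :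
    Summable (fun n : ℕ => ((2 * (n : ℝ) + 1) ^ 2) ^ j * Real.exp (-r * (2 * (n : ℝ) + 1) ^ 2)) := by
  have h := (Real.summable_pow_mul_exp_neg_nat_mul j hr).comp_injective
    (i := fun n : ℕ => (2 * n + 1) ^ 2) (by
      intro a b h
      have := Nat.pow_left_injective (n := 2) (by norm_num) h
      simpa using this)
  refine h.congr ?_
  intro n
  simp

lemma aux_summableA (j : ℕ) {r : ℝ} (hr : 0 < r) :
    Summable (fun n : ℕ => (auxA n) ^ j * Real.exp (-r * auxA n)) := by
  refine Summable.of_nonneg_of_le (fun n => mul_nonneg (pow_nonneg (auxA_nonneg n) _) (Real.exp_pos _).le) ?_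
    ((aux_summable_s15 j hr).mul_left (Real.exp r))
  intro n
  have e : Real.exp r * (((2 * (n : ℝ) + 1) ^ 2) ^ j * Real.exp (-r * (2 * (n : ℝ) + 1) ^ 2))
      = ((2 * (n : ℝ) + 1) ^ 2) ^ j * Real.exp (-r * auxA n) := by
    rw [mul_left_comm, ← Real.exp_add]
    unfold auxA
    ring_nf
  rw [e]
  apply mul_le_mul_of_nonneg_right _ (Real.exp_pos _).le
  apply pow_le_pow_left₀ (auxA_nonneg n)
  unfold auxA; nlinarith

noncomputable def auxB (s : ℝ) : ℝ := ∑' n : ℕ, Real.exp (-Real.pi * (2 * (n : ℝ) + 1) ^ 2 * s)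

lemma aux_summable0 {s : ℝ} (hs : 0 < s) :
    Summable (fun n : ℕ => Real.exp (-Real.pi * (2 * (n : ℝ) + 1) ^ 2 * s)) := by
  have := aux_summable_s15 0 (mul_pos Real.pi_pos hs)
  refine this.congr fun n => ?_
  rw [pow_zero, one_mul]; ring_nf

lemma thetaO_eq {s : ℝ} (hs : 0 < s) : thetaO s = 2 * auxB s := by
  have h := (aux_summable0 hs).hasSum
  have h2 := HasSum.of_nat_of_neg_add_one
    (f := fun k : ℤ => Real.exp (-Real.pi * (2 * (k : ℝ) + 1) ^ 2 * s))
    (m := auxB s) (by unfold auxB; simpa using h) (m' := auxB s) (by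
      unfold auxB
      convert h using 3 with n
      push_cast; ring)
  unfold thetaO
  rw [h2.tsum_eq]
  ring

lemma auxB_deriv {s : ℝ} (hs : 1 / 8 < s) :
    HasDerivAt auxB (∑' n : ℕ, Real.exp (-Real.pi * (2 * (n : ℝ) + 1) ^ 2 * s) *
      (-Real.pi * (2 * (n : ℝ) + 1) ^ 2)) s := by
  have hu := (aux_summable_s15 1 (r := Real.pi * (1/8)) (by positivity)).mul_left Real.pi
  have hs1 : s ∈ Set.Ioi (1 / 8 : ℝ) := hs
  have h0 := aux_summable0 (s := s) (by linarith)
  unfold auxB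
  refine hasDerivAt_tsum_of_isPreconnected
    (g := fun (n : ℕ) (s : ℝ) => Real.exp (-Real.pi * (2 * (n : ℝ) + 1) ^ 2 * s))
    (g' := fun (n : ℕ) (s : ℝ) => Real.exp (-Real.pi * (2 * (n : ℝ) + 1) ^ 2 * s) *
      (-Real.pi * (2 * (n : ℝ) + 1) ^ 2)) (t := Set.Ioi (1 / 8 : ℝ)) hu isOpen_Ioi
    (convex_Ioi (1/8 : ℝ)).isPreconnected ?_ ?_ (y₀ := s) hs1 h0 hs1
  · intro n y _
    have := ((hasDerivAt_id y).const_mul (-Real.pi * (2 * (n : ℝ) + 1) ^ 2)).exp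
    simpa using this
  · intro n y hy
    have hy' : (1/8 : ℝ) < y := hy
    have hp := Real.pi_pos
    rw [norm_mul, Real.norm_eq_abs, Real.norm_eq_abs, Real.abs_exp, neg_mul, abs_neg,
      abs_of_nonneg (by positivity), pow_one, mul_comm, ← mul_assoc Real.pi]
    apply mul_le_mul_of_nonneg_left _ (by positivity)
    apply Real.exp_le_exp.2
    have : 0 ≤ Real.pi * (2 * (n : ℝ) + 1) ^ 2 := by positivity
    nlinarith

noncomputable def auxC (s : ℝ) : ℝ := ∑' n : ℕ, auxA n * Real.exp (-(Real.pi * s) * auxA n)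
noncomputable def auxD (s : ℝ) : ℝ := ∑' n : ℕ, Real.exp (-(Real.pi * s) * auxA n)

lemma sumC {s : ℝ} (hs : 0 < s) :
    Summable (fun n : ℕ => auxA n * Real.exp (-(Real.pi * s) * auxA n)) := by
  simpa using aux_summableA 1 (mul_pos Real.pi_pos hs)
lemma sumD {s : ℝ} (hs : 0 < s) :
    Summable (fun n : ℕ => Real.exp (-(Real.pi * s) * auxA n)) := by
  simpa using aux_summableA 0 (mul_pos Real.pi_pos hs)

lemma auxB_eq (s : ℝ) : auxB s = Real.exp (-(Real.pi * s)) * auxD s := by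
  unfold auxB auxD
  rw [← tsum_mul_left]
  congr 1; ext n
  rw [← Real.exp_add]; unfold auxA; ring_nf

lemma auxB'_eq {s : ℝ} (hs : 0 < s) :
    (∑' n : ℕ, Real.exp (-Real.pi * (2 * (n : ℝ) + 1) ^ 2 * s) *
      (-Real.pi * (2 * (n : ℝ) + 1) ^ 2)) =
      -Real.pi * Real.exp (-(Real.pi * s)) * (auxC s + auxD s) := by
  unfold auxC auxD
  rw [← (sumC hs).tsum_add (sumD hs), ← tsum_mul_left]
  congr 1; ext n
  have : Real.exp (-Real.pi * (2 * (n : ℝ) + 1) ^ 2 * s) =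
    Real.exp (-(Real.pi * s)) * Real.exp (-(Real.pi * s) * auxA n) := by
    rw [← Real.exp_add]; unfold auxA; ring_nf
  rw [this]
  have h2 : (2 * (n : ℝ) + 1) ^ 2 = auxA n + 1 := by unfold auxA; ring
  rw [h2]; ring

lemma auxD_gt {s : ℝ} (hs : 0 < s) : 1 < auxD s := by
  unfold auxD
  rw [(sumD hs).tsum_eq_zero_add]
  have h1 : Summable (fun n : ℕ => Real.exp (-(Real.pi * s) * auxA (n + 1))) :=
    (summable_nat_add_iff 1).2 (sumD hs)
  have := h1.tsum_pos (fun n => (Real.exp_pos _).le) 0 (Real.exp_pos _)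
  have h0 : auxA 0 = 0 := by simp [auxA]
  rw [h0]
  simpa using this

lemma auxD_anti {s t : ℝ} (hs : 0 < s) (hst : s < t) : auxD t ≤ auxD s := by
  unfold auxD
  refine (sumD (hs.trans hst)).tsum_le_tsum (fun n => ?_) (sumD hs)
  apply Real.exp_le_exp.2
  have : 0 ≤ Real.pi * auxA n := mul_nonneg Real.pi_pos.le (auxA_nonneg n)
  nlinarith

lemma log_form {s : ℝ} (hs : 1 / 4 ≤ s) :
    s * deriv thetaO s / thetaO s = -Real.pi * (s + s * auxC s / auxD s) := by
  have hs0 : 0 < s := by linarith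
  have hd : HasDerivAt thetaO (2 * (-Real.pi * Real.exp (-(Real.pi * s)) * (auxC s + auxD s))) s := by
    have h := (auxB_deriv (s := s) (by linarith)).const_mul 2
    rw [auxB'_eq hs0] at h
    refine h.congr_of_eventuallyEq ?_
    filter_upwards [lt_mem_nhds hs0] with x hx
    exact thetaO_eq hx
  rw [hd.deriv, thetaO_eq hs0, auxB_eq]
  have h1 := (auxD_gt hs0)
  have h2 : auxD s ≠ 0 := by linarith
  have h3 := (Real.exp_pos (-(Real.pi * s))).ne'
  field_simp
  ring

lemma nat_bound (b : ℕ) : 8 * ((b : ℝ) + 1) ≤ 10 ^ (b + 1) := by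
  induction b with
  | zero => norm_num
  | succ k ih =>
    push_cast
    rw [pow_succ]
    have : (0:ℝ) ≤ k := k.cast_nonneg
    nlinarith

lemma term_bound {s : ℝ} (hs : 1 / 4 ≤ s) (n : ℕ) :
    Real.pi * s * auxA (n + 1) ^ 2 * Real.exp (-(Real.pi * s) * auxA (n + 1)) ≤
      (1 / 2) ^ (n + 1) := by
  obtain ⟨b, hb, hnb⟩ : ∃ b : ℕ, auxA (n + 1) = 8 * ((b : ℝ) + 1) ∧ n ≤ b := by
    obtain ⟨c, hc⟩ := (Nat.even_mul_succ_self (n + 1))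
    have hc1 : n + 1 ≤ c := by nlinarith
    refine ⟨c - 1, ?_, by omega⟩
    rw [Nat.cast_sub (by omega)]
    have : (((n + 1) * (n + 1 + 1) : ℕ) : ℝ) = ((c + c : ℕ) : ℝ) := by exact_mod_cast hc
    unfold auxA
    push_cast at this ⊢
    linarith
  set a := auxA (n + 1)
  have ha : 0 < a := by rw [hb]; positivity
  set y := Real.pi * s * a with hy
  have hy1 : 3 / 4 * a ≤ y := by
    have : 3 / 4 ≤ Real.pi * s := by nlinarith [Real.pi_gt_three]
    exact mul_le_mul_of_nonneg_right this ha.le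
  have hy0 : 0 ≤ y := by linarith
  have h1 : y ≤ Real.exp (y / 2) := by
    have := Real.quadratic_le_exp_of_nonneg (x := y / 2) (by linarith)
    nlinarith [sq_nonneg (y / 2 - 1)]
  have h2 : Real.exp (-(Real.pi * s) * a) = Real.exp (-(y / 2)) * Real.exp (-(y / 2)) := by
    rw [← Real.exp_add, hy]; ring_nf
  have h3 : y * Real.exp (-(y / 2)) ≤ 1 := by
    rw [Real.exp_neg, ← div_eq_mul_inv]
    exact (div_le_one (Real.exp_pos _)).2 h1
  have h4 : Real.exp (-(y / 2)) ≤ (1 / 20) ^ (b + 1) := by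
    have e3 : Real.exp (-3) ≤ 1 / 20 := by
      have h := Real.exp_one_gt_d9
      have h' : Real.exp 3 = Real.exp 1 ^ 3 := by rw [← Real.exp_nat_mul]; norm_num
      have : (20:ℝ) ≤ Real.exp 3 := by
        rw [h']
        calc (20:ℝ) ≤ 2.718 ^ 3 := by norm_num
          _ ≤ _ := pow_le_pow_left₀ (by norm_num) (by linarith) 3
      rw [Real.exp_neg, one_div]
      exact inv_anti₀ (by norm_num) this
    calc Real.exp (-(y / 2)) ≤ Real.exp (((b + 1 : ℕ) : ℝ) * (-3)) := by
          apply Real.exp_le_exp.2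
          push_cast
          linarith
      _ = Real.exp (-3) ^ (b + 1) := Real.exp_nat_mul _ _
      _ ≤ _ := pow_le_pow_left₀ (Real.exp_pos _).le e3 _
  calc Real.pi * s * a ^ 2 * Real.exp (-(Real.pi * s) * a)
      = (y * Real.exp (-(y / 2))) * (a * Real.exp (-(y / 2))) := by rw [h2, hy]; ring
    _ ≤ 1 * (a * Real.exp (-(y / 2))) :=
        mul_le_mul_of_nonneg_right h3 (mul_nonneg ha.le (Real.exp_pos _).le)
    _ ≤ 10 ^ (b + 1) * (1 / 20) ^ (b + 1) := by
        rw [one_mul]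
        exact mul_le_mul (hb ▸ nat_bound b) h4 (Real.exp_pos _).le (by positivity)
    _ = (1 / 2) ^ (b + 1) := by rw [← mul_pow]; norm_num
    _ ≤ _ := pow_le_pow_of_le_one (by norm_num) (by norm_num) (by omega)

lemma auxT {s : ℝ} (hs : 1 / 4 ≤ s) :
    ∑' n : ℕ, Real.pi * s * auxA n ^ 2 * Real.exp (-(Real.pi * s) * auxA n) ≤ 1 ∧
    Summable (fun n : ℕ => Real.pi * s * auxA n ^ 2 * Real.exp (-(Real.pi * s) * auxA n)) := by
  have hs0 : 0 < s := by linarith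
  have hS : Summable (fun n : ℕ => Real.pi * s * auxA n ^ 2 * Real.exp (-(Real.pi * s) * auxA n)) := by
    simpa [mul_assoc] using (aux_summableA 2 (mul_pos Real.pi_pos hs0)).mul_left (Real.pi * s)
  refine ⟨?_, hS⟩
  rw [hS.tsum_eq_zero_add]
  have h0 : auxA 0 = 0 := by simp [auxA]
  have hg : HasSum (fun n : ℕ => (1 / 2 : ℝ) ^ (n + 1)) 1 := by
    have := hasSum_geometric_two.mul_left (1 / 2 : ℝ)
    rw [show (1 / 2 : ℝ) * 2 = 1 by norm_num] at this
    have e : (fun n : ℕ => (1 / 2 : ℝ) ^ (n + 1)) = fun n : ℕ => 1 / 2 * (1 / 2 : ℝ) ^ n :=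
      funext fun n => pow_succ' _ _
    rw [e]
    exact this
  have := ((summable_nat_add_iff 1).2 hS).tsum_le_tsum (fun n => term_bound hs n) hg.summable
  rw [hg.tsum_eq] at this
  rw [h0]
  simpa using this

lemma key {s t : ℝ} (hs : 1 / 4 ≤ s) (hst : s < t) :
    s * auxC s - t * auxC t ≤ t - s := by
  have hs0 : 0 < s := by linarith
  have ht0 : 0 < t := by linarith
  obtain ⟨hT, hS⟩ := auxT hs
  have hL := ((sumC hs0).mul_left s).sub ((sumC ht0).mul_left t)
  have h1 := hL.tsum_le_tsum (g := fun n : ℕ => (t - s) *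
    (Real.pi * s * auxA n ^ 2 * Real.exp (-(Real.pi * s) * auxA n))) (fun n => by
      have ha := auxA_nonneg n
      set a := auxA n
      have he : Real.exp (-(Real.pi * t) * a) =
        Real.exp (-(Real.pi * s) * a) * Real.exp (-(Real.pi * a * (t - s))) := by
        rw [← Real.exp_add]; ring_nf
      rw [he]
      set u := Real.pi * a * (t - s) with hu
      have h2 : 1 - u ≤ Real.exp (-u) := by linarith [Real.add_one_le_exp (-u)]
      have h3 := (Real.exp_pos (-u)).le
      have h4 : s - t * Real.exp (-u) ≤ s * u := by nlinarith
      have h5 := mul_le_mul_of_nonneg_left h4 (mul_nonneg ha (Real.exp_pos (-(Real.pi * s) * a)).le)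
      calc _ = a * Real.exp (-(Real.pi * s) * a) * (s - t * Real.exp (-u)) := by ring
        _ ≤ _ := h5
        _ = _ := by rw [hu]; ring) (hS.mul_left _)
  rw [((sumC hs0).mul_left s).tsum_sub ((sumC ht0).mul_left t), tsum_mul_left, tsum_mul_left,
    tsum_mul_left] at h1
  unfold auxC
  nlinarith

theorem thetaO_log_deriv_strictAnti :
    StrictAntiOn (fun s : ℝ => s * deriv thetaO s / thetaO s)
      (Set.Ici (1 / 4)) := by
  intro s hs t ht hst
  have hs' : 1 / 4 ≤ s := hs
  have ht' : 1 / 4 ≤ t := ht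
  have hs0 : 0 < s := by linarith
  have ht0 : 0 < t := by linarith
  show t * deriv thetaO t / thetaO t < s * deriv thetaO s / thetaO s
  rw [log_form hs', log_form ht']
  have hD := auxD_anti hs0 hst
  have hDs := auxD_gt hs0
  have hDt := auxD_gt ht0
  have hC : 0 ≤ auxC t := tsum_nonneg fun n => mul_nonneg (auxA_nonneg n) (Real.exp_pos _).le
  have h1 : t * auxC t / auxD s ≤ t * auxC t / auxD t :=
    div_le_div_of_nonneg_left (mul_nonneg ht0.le hC) (by linarith) hD
  have h2 : s * auxC s / auxD s - t * auxC t / auxD s < t - s := by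
    rw [← sub_div, div_lt_iff₀ (by linarith)]
    nlinarith [key hs' hst]
  have := Real.pi_pos
  nlinarith
end

section
/- The limit of s · θₒ'(s)/θₒ(s) as s tends to 0 from the right equals −1/2. -/
open Filter Topology Set HurwitzZeta in
theorem thetaO_eq_aux {s : ℝ} (hs : 0 < s) :
    thetaO s = 1 / (4 * s) ^ (1 / 2 : ℝ) * cosKernel ((1 / 2 : ℝ) : UnitAddCircle) (1 / (4 * s)) := by
  rw [← evenKernel_functional_equation,
    ← (hasSum_int_evenKernel (1 / 2) (by positivity : 0 < 4 * s)).tsum_eq, thetaO]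
  congr 1
  ext k
  congr 1
  ring

theorem summable_aux : Summable (fun n : ℤ => Real.pi * (n : ℝ) ^ 2 * Real.exp (-Real.pi * (n : ℝ) ^ 2)) := by
  have := (HurwitzKernelBounds.summable_f_int 2 0 one_pos).mul_left Real.pi
  refine this.congr fun n => ?_
  simp [HurwitzKernelBounds.f_int, mul_assoc]

theorem term_bound_aux (n : ℤ) (c x : ℝ) (hc : |c| ≤ 1) (hx : 1 ≤ x) :
    ‖c * (Real.exp (-Real.pi * (n : ℝ) ^ 2 * x) * (-Real.pi * (n : ℝ) ^ 2))‖ ≤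
      Real.exp (-Real.pi * (x - 1)) * (Real.pi * (n : ℝ) ^ 2 * Real.exp (-Real.pi * (n : ℝ) ^ 2)) := by
  have hpi := Real.pi_pos
  by_cases hn : n = 0
  · simp [hn]
  have h1 : (1 : ℝ) ≤ (n : ℝ) ^ 2 := by
    have : 1 ≤ n ^ 2 := Int.add_one_le_iff.mpr (sq_pos_of_ne_zero hn)
    exact_mod_cast this
  have h2 : Real.exp (-Real.pi * (n : ℝ) ^ 2 * x) ≤
      Real.exp (-Real.pi * (x - 1)) * Real.exp (-Real.pi * (n : ℝ) ^ 2) := by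
    rw [← Real.exp_add, Real.exp_le_exp]
    nlinarith [mul_nonneg hpi.le (mul_nonneg (sub_nonneg.2 h1) (sub_nonneg.2 hx))]
  have e : ‖c * (Real.exp (-Real.pi * (n : ℝ) ^ 2 * x) * (-Real.pi * (n : ℝ) ^ 2))‖ =
      |c| * (Real.exp (-Real.pi * (n : ℝ) ^ 2 * x) * (Real.pi * (n : ℝ) ^ 2)) := by
    rw [Real.norm_eq_abs, abs_mul, abs_mul, Real.abs_exp, neg_mul, abs_neg,
      abs_of_nonneg (by positivity : 0 ≤ Real.pi * (n : ℝ) ^ 2)]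
  rw [e]
  calc _ ≤ 1 * ((Real.exp (-Real.pi * (x - 1)) * Real.exp (-Real.pi * (n : ℝ) ^ 2)) * (Real.pi * (n : ℝ) ^ 2)) := by
        gcongr
    _ = _ := by ring

open HurwitzZeta in
theorem cosK_hasSum_aux {x : ℝ} (hx : 0 < x) :
    HasSum (fun n : ℤ => (Complex.exp (2 * Real.pi * Complex.I * ((1 / 2 : ℝ) : ℂ) * n)).re *
      Real.exp (-Real.pi * (n : ℝ) ^ 2 * x)) (cosKernel ((1 / 2 : ℝ) : UnitAddCircle) x) := by
  have := Complex.hasSum_re (hasSum_int_cosKernel (1 / 2) hx)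
  simpa only [Complex.re_mul_ofReal, Complex.ofReal_re] using this

theorem c_bound_aux (n : ℤ) :
    |(Complex.exp (2 * Real.pi * Complex.I * ((1 / 2 : ℝ) : ℂ) * n)).re| ≤ 1 := by
  refine (Complex.abs_re_le_norm _).trans (le_of_eq ?_)
  rw [Complex.norm_exp]
  simp

open Filter Topology Set HurwitzZeta in
theorem cosK_deriv_aux : ∃ (D : ℝ → ℝ) (K : ℝ), ∀ x, 1 < x →
    HasDerivAt (fun y => cosKernel ((1 / 2 : ℝ) : UnitAddCircle) y) (D x) x ∧
      |D x| ≤ Real.exp (-Real.pi * (x - 1)) * K := by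
  refine ⟨fun x => ∑' n : ℤ, (Complex.exp (2 * Real.pi * Complex.I * ((1 / 2 : ℝ) : ℂ) * n)).re *
      (Real.exp (-Real.pi * (n : ℝ) ^ 2 * x) * (-Real.pi * (n : ℝ) ^ 2)),
    ∑' n : ℤ, Real.pi * (n : ℝ) ^ 2 * Real.exp (-Real.pi * (n : ℝ) ^ 2), fun x hx => ⟨?_, ?_⟩⟩
  · have := hasDerivAt_tsum_of_isPreconnected (𝕜 := ℝ) (y := x) (y₀ := x) (t := Ioi (1 : ℝ))
      (g := fun (n : ℤ) y => (Complex.exp (2 * Real.pi * Complex.I * ((1 / 2 : ℝ) : ℂ) * n)).re *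
        Real.exp (-Real.pi * (n : ℝ) ^ 2 * y))
      (g' := fun (n : ℤ) y => (Complex.exp (2 * Real.pi * Complex.I * ((1 / 2 : ℝ) : ℂ) * n)).re *
      (Real.exp (-Real.pi * (n : ℝ) ^ 2 * y) * (-Real.pi * (n : ℝ) ^ 2)))
      summable_aux isOpen_Ioi isPreconnected_Ioi ?_ ?_ hx (cosK_hasSum_aux (by linarith)).summable hx
    · refine this.congr_of_eventuallyEq ?_
      filter_upwards [Ioi_mem_nhds hx] with y hy
      exact (cosK_hasSum_aux (by linarith [mem_Ioi.1 hy])).tsum_eq.symm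
    · intro n y hy
      refine HasDerivAt.const_mul _ (HasDerivAt.exp ?_)
      simpa only [mul_one, id] using (hasDerivAt_id y).const_mul (-Real.pi * (n : ℝ) ^ 2)
    · intro n y hy
      have hy : 1 < y := hy
      refine (term_bound_aux n _ y (c_bound_aux n) hy.le).trans ?_
      refine mul_le_of_le_one_left (by positivity) ?_
      rw [Real.exp_le_one_iff]
      nlinarith [Real.pi_pos]
  · rw [← Real.norm_eq_abs, ← tsum_mul_left]
    exact tsum_of_norm_bounded (summable_aux.mul_left _).hasSum
      fun n => term_bound_aux n _ x (c_bound_aux n) hx.le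

open Filter Topology Set HurwitzZeta in
theorem cosK_tendsto_aux :
    Tendsto (fun y => cosKernel ((1 / 2 : ℝ) : UnitAddCircle) y) atTop (𝓝 1) := by
  obtain ⟨p, hp, h⟩ := isBigO_atTop_cosKernel_sub ((1 / 2 : ℝ) : UnitAddCircle)
  have h2 : Tendsto (fun x => Real.exp (-p * x)) atTop (𝓝 0) := by
    refine Real.tendsto_exp_atBot.comp ?_
    exact tendsto_id.const_mul_atTop_of_neg (by linarith)
  have := (h.trans_tendsto h2).add_const 1
  simpa using this

open Filter Topology Set HurwitzZeta in
theorem thetaO_log_deriv_limit :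
    Filter.Tendsto (fun s : ℝ => s * deriv thetaO s / thetaO s)
      (nhdsWithin 0 (Set.Ioi 0)) (nhds (-(1 / 2))) := by
  obtain ⟨D, K, hD⟩ := cosK_deriv_aux
  have hC := cosK_tendsto_aux
  set C : ℝ → ℝ := fun y => cosKernel ((1 / 2 : ℝ) : UnitAddCircle) y with hCdef
  have hxD : Tendsto (fun x => x * D x) atTop (𝓝 0) := by
    have h0 : Tendsto (fun x : ℝ => (x ^ 1 * Real.exp (-x)) * (Real.exp Real.pi * |K|)) atTop (𝓝 0) := by
      simpa using (Real.tendsto_pow_mul_exp_neg_atTop_nhds_zero 1).mul_const (Real.exp Real.pi * |K|)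
    refine squeeze_zero_norm' ?_ h0
    filter_upwards [eventually_gt_atTop 1] with x hx
    have hx0 : 0 < x := by linarith
    have hb := (hD x hx).2
    have he : Real.exp (-Real.pi * (x - 1)) ≤ Real.exp (-x) * Real.exp Real.pi := by
      rw [← Real.exp_add, Real.exp_le_exp]
      nlinarith [Real.pi_gt_three]
    rw [Real.norm_eq_abs, abs_mul, abs_of_pos hx0]
    calc x * |D x| ≤ x * (Real.exp (-Real.pi * (x - 1)) * |K|) := by
          gcongr
          exact hb.trans (by gcongr; exact le_abs_self K)
      _ ≤ x * ((Real.exp (-x) * Real.exp Real.pi) * |K|) := by gcongr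
      _ = _ := by ring
  have hx : Tendsto (fun s : ℝ => 1 / (4 * s)) (𝓝[>] 0) atTop := by
    have := (tendsto_inv_nhdsGT_zero (𝕜 := ℝ)).const_mul_atTop (by norm_num : (0 : ℝ) < 1 / 4)
    refine this.congr fun s => ?_
    field_simp
  have hlim : Tendsto (fun s : ℝ => -(1 / 2) - (1 / (4 * s) * D (1 / (4 * s))) / C (1 / (4 * s)))
      (𝓝[>] 0) (𝓝 (-(1 / 2))) := by
    have := ((hxD.comp hx).div (hC.comp hx) one_ne_zero).const_sub (-(1 / 2))
    simpa using this
  refine hlim.congr' ?_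
  filter_upwards [hx.eventually_gt_atTop 1, (hC.comp hx).eventually_ne one_ne_zero,
    self_mem_nhdsWithin] with s h1 hne hs
  have hs : 0 < s := hs
  have hne : C (1 / (4 * s)) ≠ 0 := hne
  have hd1 : HasDerivAt (fun s : ℝ => (4 * s) ^ (-(1 / 2) : ℝ))
      (4 * (-(1 / 2)) * (4 * s) ^ (-(1 / 2) - 1 : ℝ)) s := by
    have := HasDerivAt.rpow_const (p := (-(1 / 2) : ℝ)) ((hasDerivAt_id s).const_mul 4)
      (Or.inl (by simp; positivity))
    simpa using this
  have hd2 : HasDerivAt (fun s : ℝ => 1 / (4 * s)) (-(1 / (4 * s ^ 2))) s := by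
    have := ((hasDerivAt_id s).const_mul 4).inv (by simp; positivity)
    have e1 : (fun s : ℝ => 1 / (4 * s)) = (fun y : ℝ => 4 * id y)⁻¹ := by
      funext y
      simp only [Pi.inv_apply, id, one_div]
    have e2 : -(1 / (4 * s ^ 2)) = -(4 * 1) / (4 * id s) ^ 2 := by
      simp only [id]
      field_simp
    rw [e1, e2]
    exact this
  have hd3 := hd1.mul ((hD _ h1).1.comp s hd2)
  have heq : thetaO =ᶠ[𝓝 s] (fun s : ℝ => (4 * s) ^ (-(1 / 2) : ℝ)) * (C ∘ fun s : ℝ => 1 / (4 * s)) := by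
    filter_upwards [Ioi_mem_nhds hs] with y hy
    have hy : 0 < y := hy
    rw [thetaO_eq_aux hy]
    simp only [Pi.mul_apply, Function.comp, hCdef]
    rw [Real.rpow_neg (by positivity), one_div]
  rw [(hd3.congr_of_eventuallyEq heq).deriv, heq.eq_of_nhds]
  simp only [Pi.mul_apply, Function.comp]
  rw [Real.rpow_sub_one (by positivity)]
  have hr : (4 * s) ^ (-(1 / 2) : ℝ) ≠ 0 := by positivity
  generalize (4 * s) ^ (-(1 / 2) : ℝ) = r at *
  generalize hcc : C (1 / (4 * s)) = c at *
  generalize D (1 / (4 * s)) = d at *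
  field_simp
  ring
end

section
/- For every s > 0, one has s · θ₄'(s)/θ₄(s) > 0; in particular θ₄'(s) > 0 for all s > 0. -/
open Real Filter Topology in
lemma theta4_aux_summable (s : ℝ) (hs : 0 < s) (k : ℕ) :
    Summable (fun n : ℤ ↦ (|(n : ℝ)| ^ k) * Real.exp (-π * (n : ℝ) ^ 2 * s)) := by
  have h := summable_pow_mul_jacobiTheta₂_term_bound 0 hs k
  refine h.congr fun n => ?_
  push_cast
  congr 2
  ring

open Real Filter Topology in
lemma theta4_aux_abs (k : ℤ) : |(-1 : ℝ) ^ k| = 1 := by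
  rw [abs_zpow]; simp

open Real Filter Topology in
lemma theta4_aux_hasDerivAt (s : ℝ) (hs : 0 < s) :
    HasDerivAt theta4
      (∑' k : ℤ, (-1 : ℝ) ^ k * (Real.exp (-π * (k : ℝ) ^ 2 * s) * (-π * (k : ℝ) ^ 2))) s := by
  have hs2 : 0 < s / 2 := by positivity
  have key := hasDerivAt_tsum_of_isPreconnected (t := Set.Ioi (s / 2))
    (g := fun (k : ℤ) (x : ℝ) => (-1 : ℝ) ^ k * Real.exp (-π * (k : ℝ) ^ 2 * x))
    (g' := fun (k : ℤ) (x : ℝ) =>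
      (-1 : ℝ) ^ k * (Real.exp (-π * (k : ℝ) ^ 2 * x) * (-π * (k : ℝ) ^ 2)))
    (u := fun k : ℤ => π * (|(k : ℝ)| ^ 2 * Real.exp (-π * (k : ℝ) ^ 2 * (s / 2))))
    (y₀ := s) (y := s)
    ((theta4_aux_summable (s / 2) hs2 2).mul_left π) isOpen_Ioi isPreconnected_Ioi
    ?_ ?_ (by simp [hs]) ?_ (by simp [hs])
  · exact key
  · intro n y _
    apply HasDerivAt.const_mul
    apply HasDerivAt.exp
    have := (hasDerivAt_id y).const_mul (-π * (n : ℝ) ^ 2)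
    rw [mul_one] at this
    exact this
  · intro n y hy
    simp only [Set.mem_Ioi] at hy
    rw [Real.norm_eq_abs, abs_mul, theta4_aux_abs, abs_mul, Real.abs_exp, abs_mul, abs_neg,
      abs_of_pos pi_pos, abs_of_nonneg (sq_nonneg (n : ℝ)), sq_abs]
    have : Real.exp (-π * (n : ℝ) ^ 2 * y) ≤ Real.exp (-π * (n : ℝ) ^ 2 * (s / 2)) := by
      apply Real.exp_le_exp.2
      have : 0 ≤ π * (n : ℝ) ^ 2 := by positivity
      nlinarith
    have h2 : 0 ≤ π * (n : ℝ) ^ 2 := by positivity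
    nlinarith
  · refine (theta4_aux_summable s hs 0).of_norm_bounded fun n => ?_
    rw [Real.norm_eq_abs, abs_mul, theta4_aux_abs, Real.abs_exp]
    simp

open Real Filter Topology in
lemma theta4_aux_large (s : ℝ) (hs : 1 ≤ s) : 0 < deriv theta4 s := by
  have hs0 : 0 < s := by linarith
  rw [(theta4_aux_hasDerivAt s hs0).deriv]
  have hsum : Summable (fun k : ℤ =>
      (-1 : ℝ) ^ k * (Real.exp (-π * (k : ℝ) ^ 2 * s) * (-π * (k : ℝ) ^ 2))) := by
    refine ((theta4_aux_summable s hs0 2).mul_left π).of_norm_bounded fun n => ?_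
    rw [Real.norm_eq_abs, abs_mul, theta4_aux_abs, abs_mul, Real.abs_exp, abs_mul, abs_neg,
      abs_of_pos pi_pos, abs_of_nonneg (sq_nonneg (n : ℝ)), sq_abs]
    apply le_of_eq; ring
  rw [tsum_int_eq_zero_add_two_mul_tsum_pnat ?_ hsum]
  swap
  · intro n
    simp [zpow_neg, ← inv_zpow, inv_neg]
  rw [tsum_pnat_eq_tsum_succ (f := fun n : ℕ =>
    (-1 : ℝ) ^ (n : ℤ) * (Real.exp (-π * ((n : ℤ) : ℝ) ^ 2 * s) * (-π * ((n : ℤ) : ℝ) ^ 2)))]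
  set g : ℕ → ℝ := fun n => π * ((n + 1 : ℝ) ^ 2 * Real.exp (-π * (n + 1 : ℝ) ^ 2 * s)) with hg
  have hlt : ∀ n, g (n + 1) < g n := by
    intro n
    simp only [hg]
    push_cast
    apply mul_lt_mul_of_pos_left _ pi_pos
    have e : Real.exp (-π * (n + 1 : ℝ) ^ 2 * s)
        = Real.exp (-π * (n + 1 + 1 : ℝ) ^ 2 * s) * Real.exp (π * s * (2 * n + 3)) := by
      rw [← Real.exp_add]; congr 1; ring
    rw [e]
    have hps : 3 ≤ π * s := by nlinarith [pi_gt_three]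
    have hn : (0 : ℝ) ≤ n := Nat.cast_nonneg n
    have h1 : 6 * (n : ℝ) + 10 ≤ Real.exp (π * s * (2 * n + 3)) := by
      have := Real.add_one_le_exp (π * s * (2 * n + 3))
      nlinarith
    have h2 : (n + 1 + 1 : ℝ) ^ 2 < (n + 1 : ℝ) ^ 2 * Real.exp (π * s * (2 * n + 3)) := by
      have h3 : (n + 1 : ℝ) ^ 2 * (6 * n + 10) ≤ (n + 1 : ℝ) ^ 2 * Real.exp (π * s * (2 * n + 3)) :=
        mul_le_mul_of_nonneg_left h1 (by positivity)
      have : 0 ≤ (n : ℝ) ^ 3 := by positivity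
      nlinarith
    have := mul_lt_mul_of_pos_right h2 (Real.exp_pos (-π * (n + 1 + 1 : ℝ) ^ 2 * s))
    linarith
  have heq : ∀ n : ℕ, (-1 : ℝ) ^ ((n + 1 : ℕ) : ℤ) *
      (Real.exp (-π * (((n + 1 : ℕ) : ℤ) : ℝ) ^ 2 * s) * (-π * (((n + 1 : ℕ) : ℤ) : ℝ) ^ 2))
      = (-1) ^ n * g n := by
    intro n
    rw [zpow_natCast]
    simp only [hg]
    push_cast
    ring
  have hsumN : Summable (fun n : ℕ => (-1 : ℝ) ^ n * g n) := by
    have hinj : Function.Injective (fun n : ℕ => ((n + 1 : ℕ) : ℤ)) := by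
      intro a b h; simpa using h
    exact (hsum.comp_injective hinj).congr fun n => heq n
  have hle := (antitone_nat_of_succ_le fun n => (hlt n).le).alternating_series_le_tendsto
    hsumN.hasSum.tendsto_sum_nat 1
  have h0 := hlt 0
  simp only [mul_one, Finset.sum_range_succ, Finset.sum_range_zero, pow_zero, pow_one] at hle
  rw [tsum_congr heq]
  simp only [Int.cast_zero]
  norm_num at hle h0 ⊢
  linarith

open Real Filter Topology in
lemma theta4_aux_hasSum (s : ℝ) (hs : 0 < s) :
    HasSum (fun n : ℤ => Real.exp (-(π * ((n : ℝ) ^ 2 + n)) * (1 / s)))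
      (theta4 s * (√s * Real.exp (π / (4 * s)))) := by
  have hc : theta4 s = HurwitzZeta.cosKernel ((1 / 2 : ℝ) : UnitAddCircle) s := by
    have h := HurwitzZeta.hasSum_int_cosKernel (1 / 2) hs
    have h2 : HasSum (fun k : ℤ => (-1 : ℝ) ^ k * Real.exp (-π * (k : ℝ) ^ 2 * s))
        (HurwitzZeta.cosKernel ((1 / 2 : ℝ) : UnitAddCircle) s) := by
      rw [← Complex.hasSum_ofReal]
      convert! h using 2 with n
      push_cast
      congr 1
      rw [← Complex.exp_pi_mul_I, ← Complex.exp_int_mul]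
      congr 1
      ring
    exact h2.tsum_eq
  have hs' : 0 < 1 / s := by positivity
  have he := HurwitzZeta.hasSum_int_evenKernel (1 / 2) hs'
  rw [HurwitzZeta.evenKernel_functional_equation, one_div_one_div, ← hc] at he
  have h3 := he.mul_right (Real.exp (π / (4 * s)))
  have e1 : 1 / (1 / s) ^ (1 / 2 : ℝ) = √s := by
    rw [← Real.sqrt_eq_rpow, Real.sqrt_div zero_le_one]; simp
  rw [e1] at h3
  convert! h3 using 1
  · funext n
    rw [← Real.exp_add]
    congr 1
    field_simp
    ring
  · ring

open Real Filter Topology in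
lemma theta4_aux_pos (s : ℝ) (hs : 0 < s) : 0 < theta4 s := by
  have h := theta4_aux_hasSum s hs
  have : 0 < theta4 s * (√s * Real.exp (π / (4 * s))) := by
    rw [← h.tsum_eq]
    exact h.summable.tsum_pos (fun n => (Real.exp_pos _).le) 0 (Real.exp_pos _)
  exact pos_of_mul_pos_left this (by positivity)

open Real Filter Topology in
lemma theta4_aux_small (s : ℝ) (hs : 0 < s) (hs1 : s < 1) : 0 < deriv theta4 s := by
  set Q : ℝ → ℝ := fun s => √s * Real.exp (π / (4 * s)) with hQ
  have hmono : MonotoneOn (fun s => theta4 s * Q s) (Set.Ioi 0) := by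
    intro a ha b hb hab
    simp only [Set.mem_Ioi] at ha hb
    refine hasSum_le (fun n => ?_) (theta4_aux_hasSum a ha) (theta4_aux_hasSum b hb)
    apply Real.exp_le_exp.2
    have h1 : 1 / b ≤ 1 / a := one_div_le_one_div_of_le ha hab
    have h2 : (0 : ℝ) ≤ (n : ℝ) ^ 2 + n := by
      have : (0 : ℤ) ≤ n ^ 2 + n := by
        rcases le_or_gt 0 n with h | h <;> nlinarith
      exact_mod_cast this
    have h3 : 0 ≤ π * ((n : ℝ) ^ 2 + n) := by positivity
    nlinarith
  have hQd : HasDerivAt Q (1 / (2 * √s) * Real.exp (π / (4 * s))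
      + √s * (Real.exp (π / (4 * s)) * (-(π / (4 * s ^ 2))))) s := by
    apply (Real.hasDerivAt_sqrt hs.ne').mul
    apply HasDerivAt.exp
    have := (hasDerivAt_inv hs.ne').const_mul (π / 4)
    convert! this using 1
    · funext x
      rw [mul_comm 4 x, div_mul_eq_div_div_swap, div_eq_mul_inv]
    · field_simp
  have hd := (theta4_aux_hasDerivAt s hs).differentiableAt.hasDerivAt
  have hH := hd.mul hQd
  have hnn : 0 ≤ derivWithin (fun s => theta4 s * Q s) (Set.Ioi 0) s := hmono.derivWithin_nonneg
  rw [derivWithin_of_isOpen isOpen_Ioi hs] at hnn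
  have hH2 : deriv (fun s => theta4 s * Q s) s = _ := hH.deriv
  rw [hH2] at hnn
  have hsq : 0 < √s := Real.sqrt_pos.2 hs
  have hss : √s * √s = s := Real.mul_self_sqrt hs.le
  have hQneg : 1 / (2 * √s) * Real.exp (π / (4 * s))
      + √s * (Real.exp (π / (4 * s)) * (-(π / (4 * s ^ 2)))) < 0 := by
    have e : 1 / (2 * √s) * Real.exp (π / (4 * s))
      + √s * (Real.exp (π / (4 * s)) * (-(π / (4 * s ^ 2))))
      = √s * Real.exp (π / (4 * s)) * ((2 * s - π) / (4 * s ^ 2)) := by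
      have : 1 / (2 * √s) = √s * (1 / (2 * s)) := by
        field_simp
        rw [sq, hss]
      rw [this]
      field_simp
      ring
    rw [e]
    apply mul_neg_of_pos_of_neg (by positivity)
    apply div_neg_of_neg_of_pos _ (by positivity)
    linarith [pi_gt_three]
  have hQpos : 0 < Q s := by simp only [hQ]; positivity
  have := mul_neg_of_pos_of_neg (theta4_aux_pos s hs) hQneg
  have h5 : 0 < deriv theta4 s * Q s := by linarith
  exact pos_of_mul_pos_left h5 hQpos.le

theorem theta4_log_deriv_pos (s : ℝ) (hs : 0 < s) :
    0 < s * deriv theta4 s / theta4 s ∧ 0 < deriv theta4 s := by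
  have h : 0 < deriv theta4 s := by
    rcases lt_or_ge s 1 with h1 | h1
    · exact theta4_aux_small s hs h1
    · exact theta4_aux_large s h1
  exact ⟨div_pos (mul_pos hs h) (theta4_aux_pos s hs), h⟩
end

section
/- For every real s > 0, the Jacobi triple product representation θ₄(s) = ∏_{k=1}^∞ (1 − e^{−2kπs}) · (1 − e^{−(2k−1)πs})² holds. -/
open Filter Topology

noncomputable def qP (q : ℝ) (n : ℕ) : ℝ := ∏ i ∈ Finset.range n, (1 - (q ^ 2) ^ (i + 1))

noncomputable def qR (q : ℝ) (m : ℤ) : ℝ := if 0 ≤ m then (qP q m.toNat)⁻¹ else 0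

noncomputable def qW (q : ℝ) (n : ℕ) (j : ℤ) : ℝ :=
  (-1 : ℝ) ^ j * q ^ (j ^ 2) * (qR q (n + j) * qR q (n - j))

lemma fac_ne {q : ℝ} (h0 : 0 < q) (h1 : q < 1) (i : ℕ) : 1 - (q ^ 2) ^ (i + 1) ≠ 0 := by
  have : (q ^ 2) ^ (i + 1) < 1 := pow_lt_one₀ (by positivity) (by nlinarith) (by omega)
  linarith

lemma qP_ne {q : ℝ} (h0 : 0 < q) (h1 : q < 1) (n : ℕ) : qP q n ≠ 0 :=
  Finset.prod_ne_zero_iff.mpr fun i _ => fac_ne h0 h1 i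

lemma qR_rec {q : ℝ} (h0 : 0 < q) (h1 : q < 1) (m : ℤ) :
    qR q (m - 1) = (1 - (q ^ 2) ^ m) * qR q m := by
  rcases lt_trichotomy m 0 with h | h | h
  · simp [qR, not_le.mpr h, show ¬ (1 ≤ m) by omega]
  · subst h; simp [qR]
  · obtain ⟨k, rfl⟩ : ∃ k : ℕ, m = k + 1 := ⟨(m - 1).toNat, by omega⟩
    have e1 : ((k : ℤ) + 1).toNat = k + 1 := by omega
    have e2 : (q ^ 2) ^ ((k : ℤ) + 1) = (q ^ 2) ^ (k + 1) := by norm_cast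
    have := fac_ne h0 h1 k
    have h2 := qP_ne h0 h1 k
    rw [e2]
    simp only [qR, add_sub_cancel_right, e1, Int.toNat_natCast]
    rw [if_pos (by omega), if_pos (by omega)]
    simp only [qP, Finset.prod_range_succ] at *
    field_simp

lemma summ_sq {q : ℝ} (h0 : 0 < q) (h1 : q < 1) : Summable fun j : ℤ => q ^ (j ^ 2) := by
  have : Summable fun n : ℕ => q ^ (n ^ 2) :=
    Summable.of_nonneg_of_le (fun n => by positivity)
      (fun n => pow_le_pow_of_le_one h0.le h1.le (Nat.le_self_pow (by norm_num) n))
      (summable_geometric_of_lt_one h0.le h1)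
  apply Summable.of_nat_of_neg
  · exact this.congr fun n => by rw [← zpow_natCast]; push_cast; rfl
  · exact this.congr fun n => by rw [neg_sq, ← zpow_natCast]; push_cast; rfl

lemma qP_tendsto {q : ℝ} (h0 : 0 < q) (h1 : q < 1) :
    Multipliable (fun i : ℕ => 1 - (q ^ 2) ^ (i + 1)) ∧
    (∏' i : ℕ, (1 - (q ^ 2) ^ (i + 1))) ≠ 0 ∧
    Tendsto (qP q) atTop (𝓝 (∏' i : ℕ, (1 - (q ^ 2) ^ (i + 1)))) := by
  have hs : Summable (fun i : ℕ => ‖-(q ^ 2) ^ (i + 1)‖) := by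
    have : Summable (fun i : ℕ => (q ^ 2) ^ (i + 1)) :=
      (summable_nat_add_iff 1).2 (summable_geometric_of_lt_one (by positivity) (by nlinarith))
    simpa using this.norm
  have hm := multipliable_one_add_of_summable hs
  have hn := tprod_one_add_ne_zero_of_summable (f := fun i : ℕ => -(q ^ 2) ^ (i + 1))
    (fun i => by simpa [sub_eq_add_neg] using fac_ne h0 h1 i) hs
  simp only [← sub_eq_add_neg] at hm hn
  exact ⟨hm, hn, hm.tendsto_prod_tprod_nat⟩

lemma qR_tendsto {q : ℝ} (h0 : 0 < q) (h1 : q < 1) :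
    Tendsto (qR q) atTop (𝓝 (∏' i : ℕ, (1 - (q ^ 2) ^ (i + 1)))⁻¹) := by
  have h := (qP_tendsto h0 h1).2.2.inv₀ (qP_tendsto h0 h1).2.1
  have ht : Tendsto Int.toNat atTop atTop := by
    refine tendsto_atTop.2 fun b => ?_
    filter_upwards [eventually_ge_atTop (b : ℤ)] with a ha
    omega
  refine (h.comp ht).congr' ?_
  filter_upwards [eventually_ge_atTop 0] with a ha
  simp [qR, ha]

lemma qR_bdd {q : ℝ} (h0 : 0 < q) (h1 : q < 1) : ∃ C, ∀ m, |qR q m| ≤ C := by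
  have h := (qP_tendsto h0 h1).2.2.inv₀ (qP_tendsto h0 h1).2.1
  obtain ⟨C, hC⟩ := h.abs.bddAbove_range
  have hC' : ∀ n, |(qP q n)⁻¹| ≤ C := fun n => hC ⟨n, rfl⟩
  refine ⟨C, fun m => ?_⟩
  unfold qR
  split_ifs
  · exact hC' _
  · simpa using (abs_nonneg _).trans (hC' 0)

lemma qW_bound {q : ℝ} (h0 : 0 < q) (h1 : q < 1) :
    ∃ C, ∀ n j, ‖qW q n j‖ ≤ C * q ^ (j ^ 2) := by
  obtain ⟨C, hC⟩ := qR_bdd h0 h1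
  refine ⟨C * C, fun n j => ?_⟩
  have hp : 0 < q ^ (j ^ 2) := by positivity
  have : ‖qW q n j‖ = q ^ (j ^ 2) * (|qR q (n + j)| * |qR q (n - j)|) := by
    simp only [qW, Real.norm_eq_abs, abs_mul, abs_zpow, abs_neg, abs_one, one_zpow, one_mul,
      abs_of_pos h0]
  rw [this, mul_comm]
  have := mul_le_mul (hC (n + j)) (hC (n - j)) (abs_nonneg _) ((abs_nonneg _).trans (hC 0))
  gcongr

lemma qW_summ {q : ℝ} (h0 : 0 < q) (h1 : q < 1) (n : ℕ) : Summable (qW q n) := by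
  obtain ⟨C, hC⟩ := qW_bound h0 h1
  exact Summable.of_norm_bounded ((summ_sq h0 h1).mul_left C) (hC n)

lemma qW_rec {q : ℝ} (h0 : 0 < q) (h1 : q < 1) (n : ℕ) (j : ℤ) :
    (1 - (q ^ 2) ^ (2 * n + 1)) * (1 - (q ^ 2) ^ (2 * n + 2)) * qW q (n + 1) j =
      (1 + (q ^ 2) ^ (2 * n + 1)) * qW q n j
        - q ^ (2 * n + 1) * (qW q n (j - 1) + qW q n (j + 1)) := by
  have hq : q ≠ 0 := h0.ne'
  set A := qR q (n + 1 + j) with hA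
  set B := qR q (n + 1 - j) with hB
  set u := (q ^ 2) ^ ((n : ℤ) + 1 + j) with hu
  set v := (q ^ 2) ^ ((n : ℤ) + 1 - j) with hv
  have a1 : qR q (n + j) = (1 - u) * A := by
    rw [hA, hu, ← qR_rec h0 h1]; congr 1; ring
  have b1 : qR q (n - j) = (1 - v) * B := by
    rw [hB, hv, ← qR_rec h0 h1]; congr 1; ring
  have a2 : qR q (n + (j - 1)) = (1 - u / q ^ 2) * ((1 - u) * A) := by
    rw [← a1, hu, div_eq_mul_inv, ← zpow_sub_one₀ (by positivity : q ^ 2 ≠ 0)]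
    convert qR_rec h0 h1 (n + j) using 3 <;> ring_nf
  have b2 : qR q (n - (j + 1)) = (1 - v / q ^ 2) * ((1 - v) * B) := by
    rw [← b1, hv, div_eq_mul_inv, ← zpow_sub_one₀ (by positivity : q ^ 2 ≠ 0)]
    rw [show (n : ℤ) - (j + 1) = n - j - 1 by ring, show (n : ℤ) + 1 - j - 1 = n - j by ring]
    exact qR_rec h0 h1 (n - j)
  have a3 : qR q (n + (j + 1)) = A := by rw [hA]; congr 1; ring
  have b3 : qR q (n - (j - 1)) = B := by rw [hB]; congr 1; ring
  have huv : (q ^ 2) ^ (2 * n + 2) = u * v := by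
    rw [hu, hv, ← zpow_add₀ (by positivity), ← zpow_natCast]; congr 1; push_cast; ring
  have huv' : (q ^ 2) ^ (2 * n + 1) = u * v / q ^ 2 := by
    rw [← huv]; field_simp; ring
  have m1 : (-1 : ℝ) ^ (j - 1) = - (-1) ^ j := by rw [zpow_sub_one₀ (by norm_num)]; norm_num
  have m2 : (-1 : ℝ) ^ (j + 1) = - (-1) ^ j := by rw [zpow_add_one₀ (by norm_num)]; norm_num
  have s1 : q ^ (2 * n + 1) * q ^ ((j - 1) ^ 2) = q ^ (j ^ 2) * v := by
    have : v = q ^ (2 * ((n : ℤ) + 1 - j)) := by rw [hv, zpow_mul]; norm_cast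
    rw [this, ← zpow_natCast, ← zpow_add₀ hq, ← zpow_add₀ hq]; congr 1; push_cast; ring
  have s2 : q ^ (2 * n + 1) * q ^ ((j + 1) ^ 2) = q ^ (j ^ 2) * u := by
    have : u = q ^ (2 * ((n : ℤ) + 1 + j)) := by rw [hu, zpow_mul]; norm_cast
    rw [this, ← zpow_natCast, ← zpow_add₀ hq, ← zpow_add₀ hq]; congr 1; push_cast; ring
  have c1 : q ^ (2 * n + 1) * qW q n (j - 1) =
      -(-1) ^ j * (q ^ (j ^ 2) * v) * ((1 - u / q ^ 2) * ((1 - u) * A) * B) := by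
    rw [← s1, qW, m1, a2, b3]; ring
  have c2 : q ^ (2 * n + 1) * qW q n (j + 1) =
      -(-1) ^ j * (q ^ (j ^ 2) * u) * (A * ((1 - v / q ^ 2) * ((1 - v) * B))) := by
    rw [← s2, qW, m2, a3, b2]; ring
  rw [mul_add, c1, c2, huv, huv']
  simp only [qW, a1, b1]
  push_cast
  rw [← hA, ← hB]
  ring

lemma qF_rec {q : ℝ} (h0 : 0 < q) (h1 : q < 1) (n : ℕ) :
    (1 - (q ^ 2) ^ (2 * n + 1)) * (1 - (q ^ 2) ^ (2 * n + 2)) * ∑' j, qW q (n + 1) j =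
      (1 - q ^ (2 * n + 1)) ^ 2 * ∑' j, qW q n j := by
  have hs := qW_summ h0 h1 n
  have e1 : HasSum (fun j => qW q n (j - 1)) (∑' j, qW q n j) :=
    (Equiv.subRight (1 : ℤ)).hasSum_iff.2 hs.hasSum
  have e2 : HasSum (fun j => qW q n (j + 1)) (∑' j, qW q n j) :=
    (Equiv.addRight (1 : ℤ)).hasSum_iff.2 hs.hasSum
  rw [← tsum_mul_left]
  simp only [qW_rec h0 h1]
  rw [((hs.hasSum.mul_left _).sub ((e1.add e2).mul_left _)).tsum_eq]
  ring

lemma qF_eq {q : ℝ} (h0 : 0 < q) (h1 : q < 1) (n : ℕ) :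
    qP q (2 * n) * ∑' j, qW q n j = ∏ k ∈ Finset.range n, (1 - q ^ (2 * k + 1)) ^ 2 := by
  induction n with
  | zero =>
    rw [tsum_eq_single 0]
    · simp [qW, qR, qP]
    · intro j hj
      rcases lt_or_gt_of_ne hj with h | h
      · simp [qW, qR, not_le.mpr h]
      · simp [qW, qR, not_le.mpr h]
  | succ n ih =>
    rw [Finset.prod_range_succ, ← ih, mul_right_comm, mul_assoc,
      ← qF_rec h0 h1]
    rw [show 2 * (n + 1) = 2 * n + 1 + 1 by ring]
    simp only [qP, Finset.prod_range_succ]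
    ring

lemma qF_tendsto {q : ℝ} (h0 : 0 < q) (h1 : q < 1) :
    Tendsto (fun n => ∑' j, qW q n j) atTop (𝓝 (∑' j : ℤ, (-1 : ℝ) ^ j * q ^ (j ^ 2) *
      ((∏' i : ℕ, (1 - (q ^ 2) ^ (i + 1)))⁻¹ * (∏' i : ℕ, (1 - (q ^ 2) ^ (i + 1)))⁻¹))) := by
  obtain ⟨C, hC⟩ := qW_bound h0 h1
  refine tendsto_tsum_of_dominated_convergence ((summ_sq h0 h1).mul_left C) (fun j => ?_)
    (Eventually.of_forall hC)
  have hr := qR_tendsto h0 h1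
  have t := tendsto_natCast_atTop_atTop (R := ℤ)
  exact ((hr.comp (tendsto_atTop_add_const_right _ j t)).mul
    (hr.comp (tendsto_atTop_add_const_right _ (-j) t))).const_mul _

lemma main_q {q : ℝ} (h0 : 0 < q) (h1 : q < 1) :
    ∑' j : ℤ, (-1 : ℝ) ^ j * q ^ (j ^ 2) =
      ∏' k : ℕ, (1 - (q ^ 2) ^ (k + 1)) * (1 - q ^ (2 * k + 1)) ^ 2 := by
  obtain ⟨hm, hn, ht⟩ := qP_tendsto h0 h1
  have hs : Summable (fun i : ℕ => ‖-q ^ (2 * i + 1)‖) := by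
    have : Summable (fun i : ℕ => q ^ (2 * i + 1)) :=
      (summable_geometric_of_lt_one h0.le h1).comp_injective
        (i := fun i : ℕ => 2 * i + 1) (fun a b h => by simpa using h)
    simpa using this.norm
  have hm2 := multipliable_one_add_of_summable hs
  simp only [← sub_eq_add_neg] at hm2
  have hm3 := hm2.pow 2
  have l1 := hm3.tendsto_prod_tprod_nat
  have t2 : Tendsto (fun n : ℕ => 2 * n) atTop atTop :=
    tendsto_id.const_mul_atTop' (by norm_num)
  have l2 := (ht.comp t2).mul (qF_tendsto h0 h1)
  have := tendsto_nhds_unique (l2.congr fun n => qF_eq h0 h1 n) l1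
  rw [hm.tprod_mul hm3, ← this, tsum_mul_right]
  field_simp

theorem theta4_triple_product (s : ℝ) (hs : 0 < s) :
    theta4 s = ∏' k : ℕ,
      (1 - Real.exp (-(2 * ((k : ℝ) + 1)) * Real.pi * s)) *
        (1 - Real.exp (-(2 * ((k : ℝ) + 1) - 1) * Real.pi * s)) ^ 2 := by
  have h1 : Real.exp (-Real.pi * s) < 1 := by
    rw [Real.exp_lt_one_iff]
    have := mul_pos Real.pi_pos hs
    linarith
  have h := main_q (Real.exp_pos (-Real.pi * s)) h1
  unfold theta4
  convert h using 3 with k k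
  · congr 1; rw [← Real.rpow_intCast, ← Real.exp_mul]; congr 1; push_cast; ring
  · congr 1
    · rw [← pow_mul, ← Real.exp_nat_mul]; congr 2; push_cast; ring
    · rw [← Real.exp_nat_mul]; congr 3; push_cast; ring
end
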